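/- arXiv:2112.12915 — 2 statements merged into one kernel-verified Lean document; each statement's English description precedes it below -/
import Mathlib

section
/- The reduced cohomology groups of the Schrödinger-Virasoro conformal algebra with trivial coefficients have dimensions: dim H^q(SV,ℂ) = 1 for q = 0, 2, 3; dim H^q(SV,ℂ) = 2 for q = 4, 6; dim H^q(SV,ℂ) = 4 for q = 5; and H^q(SV,ℂ) = 0 for all other q ∈ ℤ≥0 (namely q = 1 and q ≥ 7). -/
/-!
Cochain complex of the Schrödinger–Virasoro conformal algebra
`SV = ℂ[∂]L ⊕ ℂ[∂]Y ⊕ ℂ[∂]M` with coefficients in the trivial module `ℂ_a`.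

Since `SV` is a free `ℂ[∂]`-module on the generators `L, Y, M`, and since a
`q`-cochain (a `ℂ`-linear, conformally antilinear map `SV^{⊗q} → ℂ[λ₁,…,λ_q]`)
is uniquely determined by its values on `q`-tuples of generators, we model
cochains as functions from generator tuples to `ℂ[λ₁,…,λ_q]`, subject to the
skew-symmetry condition (simultaneous permutation of the entries and the
variables `λᵢ`).
-/

namespace SVCA

open MvPolynomial

/-- The generators `L`, `Y`, `M` of the Schrödinger–Virasoro conformal algebra. -/
inductive SVGen : Type
  | L | Y | M
  deriving DecidableEq

open SVGen

/-- The λ-brackets on generators: `SVbrk a b = (x, c₁, c₂)` encodes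
`[a_λ b] = (c₁ ∂ + c₂ λ) x`.  Zero brackets are encoded by zero coefficients:
`[L_λ L] = (∂+2λ)L`, `[L_λ Y] = (∂+(3/2)λ)Y`, `[Y_λ L] = ((1/2)∂+(3/2)λ)Y`,
`[Y_λ Y] = (∂+2λ)M`, `[L_λ M] = (∂+λ)M`, `[M_λ L] = λM`, and
`[Y_λ M] = [M_λ Y] = [M_λ M] = 0`. -/
noncomputable def SVbrk : SVGen → SVGen → SVGen × ℂ × ℂ
  | L, L => (L, 1, 2)
  | L, Y => (Y, 1, 3/2)
  | Y, L => (Y, 1/2, 3/2)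
  | Y, Y => (M, 1, 2)
  | L, M => (M, 1, 1)
  | M, L => (M, 0, 1)
  | _, _ => (M, 0, 0)

/-- The space of (not necessarily skew-symmetric) `q`-cochains with trivial
coefficients: functions from `q`-tuples of generators to `ℂ[λ₁,…,λ_q]`. -/
abbrev SVRaw (q : ℕ) := (Fin q → SVGen) → MvPolynomial (Fin q) ℂ

/-- The `ℂ`-subspace `C̃^q(SV,ℂ)` of `q`-cochains: skew-symmetry with respect to
simultaneous permutations of the arguments and of the variables `λᵢ`. -/
noncomputable def SVCochain (q : ℕ) : Submodule ℂ (SVRaw q) where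
  carrier := {c | ∀ (σ : Equiv.Perm (Fin q)) (a : Fin q → SVGen),
      rename σ (c (a ∘ σ)) = ((Equiv.Perm.sign σ : ℤ) : ℂ) • c a}
  add_mem' := by
    intro c c' hc hc' σ a
    simp only [Pi.add_apply, map_add, hc σ a, hc' σ a, smul_add]
  zero_mem' := by intro σ a; simp
  smul_mem' := by
    intro r c hc σ a
    simp only [Pi.smul_apply, map_smul, hc σ a]
    rw [smul_comm]

/-- The strictly increasing embedding `Fin q → Fin (q+2)` omitting `i` and `j`
(meaningful for `i < j`; junk otherwise). -/
def SVskip {q : ℕ} (i j : Fin (q + 2)) (k : Fin q) : Fin (q + 2) :=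
  j.succAbove ((⟨min (i : ℕ) q, Nat.lt_succ_of_le (Nat.min_le_right _ _)⟩ : Fin (q + 1)).succAbove k)

/-- The `(i,j)`-summand of the differential (trivial coefficients):
`(-1)^{i+j} γ_{λᵢ+λⱼ, λ₁, …, λ̂ᵢ, …, λ̂ⱼ, …}([a_{i λᵢ} a_j], a₁, …, âᵢ, …, âⱼ, …)`,
where `[a_{i λᵢ} a_j] = (c₁∂ + c₂λᵢ)x` and conformal antilinearity in the first
slot (whose variable is `λᵢ+λⱼ`) produces the factor `c₂λᵢ - c₁(λᵢ+λⱼ)`. -/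
noncomputable def SVdTerm {q : ℕ} (c : SVRaw (q + 1)) (a : Fin (q + 2) → SVGen)
    (i j : Fin (q + 2)) : MvPolynomial (Fin (q + 2)) ℂ :=
  ((-1 : ℂ) ^ ((i : ℕ) + (j : ℕ))) •
    ((C (SVbrk (a i) (a j)).2.2 * X i - C (SVbrk (a i) (a j)).2.1 * (X i + X j)) *
      aeval (Fin.cons (X i + X j) fun k => X (SVskip i j k))
        (c (Fin.cons (SVbrk (a i) (a j)).1 fun k => a (SVskip i j k))))

/-- The differential `d_q : C̃^q → C̃^{q+1}` (trivial coefficients). -/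
noncomputable def SVd : {q : ℕ} → SVRaw q → SVRaw (q + 1)
  | 0, _ => 0
  | (q + 1), c => fun a =>
      ∑ i : Fin (q + 2), ∑ j : Fin (q + 2),
        if (i : ℕ) < (j : ℕ) then SVdTerm c a i j else 0

lemma SVdTerm_add {q : ℕ} (c c' : SVRaw (q + 1)) (a : Fin (q + 2) → SVGen)
    (i j : Fin (q + 2)) :
    SVdTerm (c + c') a i j = SVdTerm c a i j + SVdTerm c' a i j := by
  simp [SVdTerm, mul_add, smul_add]

lemma SVdTerm_smul {q : ℕ} (r : ℂ) (c : SVRaw (q + 1)) (a : Fin (q + 2) → SVGen)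
    (i j : Fin (q + 2)) :
    SVdTerm (r • c) a i j = r • SVdTerm c a i j := by
  simp only [SVdTerm, Pi.smul_apply, map_smul, mul_smul_comm]
  rw [smul_comm]

/-- The differential as a `ℂ`-linear map. -/
noncomputable def SVdLin (q : ℕ) : SVRaw q →ₗ[ℂ] SVRaw (q + 1) where
  toFun := SVd
  map_add' c c' := by
    cases q with
    | zero => simp [SVd]
    | succ q =>
      funext a
      simp only [SVd, Pi.add_apply]
      rw [← Finset.sum_add_distrib]
      refine Finset.sum_congr rfl fun i _ => ?_
      rw [← Finset.sum_add_distrib]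
      refine Finset.sum_congr rfl fun j _ => ?_
      by_cases h : (i : ℕ) < (j : ℕ)
      · simp [h, SVdTerm_add]
      · simp [h]
  map_smul' r c := by
    cases q with
    | zero => simp [SVd]
    | succ q =>
      funext a
      simp only [SVd, RingHom.id_apply, Pi.smul_apply, Finset.smul_sum]
      refine Finset.sum_congr rfl fun i _ => ?_
      refine Finset.sum_congr rfl fun j _ => ?_
      by_cases h : (i : ℕ) < (j : ℕ)
      · simp [h, SVdTerm_smul]
      · simp [h]

/-- The space `D̃^q(SV,ℂ)` of `q`-cocycles: skew-symmetric cochains with `dγ = 0`. -/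
noncomputable def SVcocycles (q : ℕ) : Submodule ℂ (SVRaw q) :=
  SVCochain q ⊓ LinearMap.ker (SVdLin q)

/-- The space `B̃^q(SV,ℂ)` of `q`-coboundaries: differentials of `(q-1)`-cochains
(`0` for `q = 0`). -/
noncomputable def SVcoboundaries : (q : ℕ) → Submodule ℂ (SVRaw q)
  | 0 => ⊥
  | (q + 1) => Submodule.map (SVdLin q) (SVCochain q)

/-- The basic cohomology `H̃^q(SV,ℂ)` = cocycles / coboundaries. -/
noncomputable def SVbasicH (q : ℕ) :=
  SVcocycles q ⧸ Submodule.comap (SVcocycles q).subtype (SVcoboundaries q)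


noncomputable instance (q : ℕ) : AddCommGroup (SVbasicH q) := by
  unfold SVbasicH; infer_instance
noncomputable instance (q : ℕ) : Module ℂ (SVbasicH q) := by
  unfold SVbasicH; infer_instance

/-- The action of `∂` on `q`-cochains with coefficients in `ℂ_a`:
`(∂γ)_{λ₁,…,λ_q} = (a + λ₁ + ⋯ + λ_q)·γ_{λ₁,…,λ_q}`.  (The trivial module `ℂ`
is the case `a = 0`.) -/
noncomputable def SVpartial (a : ℂ) (q : ℕ) : SVRaw q →ₗ[ℂ] SVRaw q where
  toFun c := fun t => (C a + ∑ i, X i) * c t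
  map_add' c c' := by funext t; simp [mul_add]
  map_smul' r c := by funext t; simp [mul_smul_comm]

/-- The subspace `∂C̃^q ⊆ C̃^q` (with coefficients in `ℂ_a`). -/
noncomputable def SVpartialSub (a : ℂ) (q : ℕ) : Submodule ℂ (SVRaw q) :=
  Submodule.map (SVpartial a q) (SVCochain q)

/-- `q`-cochains representing reduced `q`-cocycles: cochains `γ` with
`dγ ∈ ∂C̃^{q+1}` (these are exactly the representatives of `ker d̄`
in the quotient complex `C̃^•/∂C̃^•`). -/
noncomputable def SVredCocycles (a : ℂ) (q : ℕ) : Submodule ℂ (SVRaw q) :=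
  SVCochain q ⊓ Submodule.comap (SVdLin q) (SVpartialSub a (q + 1))

/-- `q`-cochains representing reduced `q`-coboundaries: `∂C̃^q + dC̃^{q-1}`
(these are exactly the representatives of `im d̄` in the quotient complex). -/
noncomputable def SVredCoboundaries (a : ℂ) : (q : ℕ) → Submodule ℂ (SVRaw q)
  | 0 => SVpartialSub a 0
  | (q + 1) => SVpartialSub a (q + 1) ⊔ Submodule.map (SVdLin q) (SVCochain q)

/-- The reduced cohomology `H^q(SV,ℂ_a)`, realized (via the third isomorphism
theorem) as `{γ ∈ C̃^q : dγ ∈ ∂C̃^{q+1}} / (∂C̃^q + dC̃^{q-1})`. -/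
noncomputable def SVredH (a : ℂ) (q : ℕ) :=
  SVredCocycles a q ⧸ Submodule.comap (SVredCocycles a q).subtype (SVredCoboundaries a q)


noncomputable instance (a : ℂ) (q : ℕ) : AddCommGroup (SVredH a q) := by
  unfold SVredH; infer_instance
noncomputable instance (a : ℂ) (q : ℕ) : Module ℂ (SVredH a q) := by
  unfold SVredH; infer_instance

/-- The cocycles of the subcomplex `∂C̃^•` (trivial coefficients `ℂ`). -/
noncomputable def SVsubCocycles (q : ℕ) : Submodule ℂ (SVRaw q) :=
  SVpartialSub 0 q ⊓ LinearMap.ker (SVdLin q)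

/-- The coboundaries of the subcomplex `∂C̃^•` (trivial coefficients `ℂ`). -/
noncomputable def SVsubCoboundaries : (q : ℕ) → Submodule ℂ (SVRaw q)
  | 0 => ⊥
  | (q + 1) => Submodule.map (SVdLin q) (SVpartialSub 0 q)

/-- The cohomology `H^q(∂C̃^•)` of the subcomplex `∂C̃^•` (trivial coefficients). -/
noncomputable def SVsubH (q : ℕ) :=
  SVsubCocycles q ⧸ Submodule.comap (SVsubCocycles q).subtype (SVsubCoboundaries q)


noncomputable instance (q : ℕ) : AddCommGroup (SVsubH q) := by
  unfold SVsubH; infer_instance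
noncomputable instance (q : ℕ) : Module ℂ (SVsubH q) := by
  unfold SVsubH; infer_instance

/-- The operator `τ`:
`(τγ)_{λ₁,…,λ_{q-1}}(a₁,…,a_{q-1}) = (-1)^{q-1} ∂/∂λ γ_{λ₁,…,λ_{q-1},λ}(a₁,…,a_{q-1},L)|_{λ=0}`. -/
noncomputable def SVtau {q : ℕ} (c : SVRaw (q + 1)) : SVRaw q := fun a =>
  ((-1 : ℂ) ^ q) •
    aeval (Fin.snoc (fun i : Fin q => X i) 0)
      (pderiv (Fin.last q) (c (Fin.snoc a SVGen.L)))

/-- The operator `τ₂`: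
`(τ₂γ)_{λ₁,…,λ_{q-1}}(a₁,…,a_{q-1}) = (-1)^{q-1} γ_{λ₁,…,λ_{q-1},λ}(a₁,…,a_{q-1},L)|_{λ=0}`. -/
noncomputable def SVtau2 {q : ℕ} (c : SVRaw (q + 1)) : SVRaw q := fun a =>
  ((-1 : ℂ) ^ q) • aeval (Fin.snoc (fun i : Fin q => X i) 0) (c (Fin.snoc a SVGen.L))

/-- The tuple with `k` copies of `L`, then `l` copies of `Y`, then copies of `M`. -/
def SVtuple (q k l : ℕ) : Fin q → SVGen := fun i =>
  if (i : ℕ) < k then SVGen.L else if (i : ℕ) < k + l then SVGen.Y else SVGen.M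

/-- `∏_{i<j ∈ s} (λᵢ - λⱼ)`. -/
noncomputable def SVvandermonde (q : ℕ) (s : Finset (Fin q)) : MvPolynomial (Fin q) ℂ :=
  ∏ p ∈ (s ×ˢ s).filter fun p => p.1 < p.2, (X p.1 - X p.2)

/-- A basis vector `(g, n)` of the annihilation Lie algebra: it stands for the `n`-th mode of the
generator `g`. -/
abbrev Mode := SVGen × ℕ

/-- The structure constant of the bracket of two modes. -/
noncomputable def modeCoef (u v : Mode) : ℂ :=
  (SVbrk u.1 v.1).2.2 * u.2 - (SVbrk u.1 v.1).2.1 * (u.2 + v.2)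

/-- The mode of which the bracket of two modes is a multiple. -/
noncomputable def modeBrk (u v : Mode) : Mode := ((SVbrk u.1 v.1).1, u.2 + v.2 - 1)

/-- Functions on words in the modes; cochains of all degrees are encoded in this way. -/
abbrev WordFun := List Mode → ℂ

/-- Contraction of a word function with a mode. -/
def contr (u : Mode) (F : WordFun) : WordFun := fun l => F (u :: l)

/-- The transpose of the adjoint action of a mode. -/
noncomputable def lieAct (u : Mode) : WordFun → WordFun
  | _, [] => 0
  | F, v :: l => modeCoef u v * F (modeBrk u v :: l) + lieAct u (contr v F) l

/-- The Chevalley–Eilenberg differential, defined through Cartan's formula. -/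
noncomputable def wordD : WordFun → WordFun
  | _, [] => 0
  | F, u :: l => -lieAct u F l - wordD (contr u F) l

/-- Word functions that change sign when two neighbouring letters are exchanged. -/
def IsAlt (F : WordFun) : Prop :=
  ∀ l₁ u v l₂, F (l₁ ++ u :: v :: l₂) = -F (l₁ ++ v :: u :: l₂)

lemma modeCoef_skew (f : Mode → ℂ) (u v : Mode) :
    modeCoef u v * f (modeBrk u v) = -(modeCoef v u * f (modeBrk v u)) := by
  obtain ⟨g, m⟩ := u
  obtain ⟨h, n⟩ := v
  have e : m + n - 1 = n + m - 1 := by omega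
  cases g <;> cases h <;> simp only [modeCoef, modeBrk, SVbrk, e] <;> ring

lemma modeCoef_jacobi (f : Mode → ℂ) (u v w : Mode) :
    modeCoef u w * (modeCoef v (modeBrk u w) * f (modeBrk v (modeBrk u w))) -
      modeCoef v w * (modeCoef u (modeBrk v w) * f (modeBrk u (modeBrk v w))) =
    -(modeCoef u v * (modeCoef (modeBrk u v) w * f (modeBrk (modeBrk u v) w))) := by
  obtain ⟨g, m⟩ := u
  obtain ⟨h, n⟩ := v
  obtain ⟨k, p⟩ := w
  have cast : ∀ a b : ℕ, ((a + b - 1 : ℕ) : ℂ) = a + b - 1 ∨ (a = 0 ∧ b = 0) := by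
    intro a b
    rcases Nat.eq_zero_or_pos (a + b) with h | h
    · right; omega
    · left; push_cast [Nat.cast_sub h]; ring
  have e1 : n + (m + p - 1) - 1 = m + n + p - 2 ∨ (m = 0 ∧ p = 0) := by omega
  have e2 : m + (n + p - 1) - 1 = m + n + p - 2 ∨ (n = 0 ∧ p = 0) := by omega
  have e3 : m + n - 1 + p - 1 = m + n + p - 2 ∨ (m = 0 ∧ n = 0) := by omega
  rcases cast m p with c1 | ⟨rfl, rfl⟩
  · rcases cast n p with c2 | ⟨rfl, rfl⟩
    · rcases cast m n with c3 | ⟨rfl, rfl⟩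
      · rcases e1 with e1 | ⟨rfl, rfl⟩
        · rcases e2 with e2 | ⟨rfl, rfl⟩
          · rcases e3 with e3 | ⟨rfl, rfl⟩
            · cases g <;> cases h <;> cases k <;>
                simp only [modeCoef, modeBrk, SVbrk, e1, e2, e3, c1, c2, c3] <;> ring
            · norm_num at c3
          · norm_num at c2
        · norm_num at c1
      · rcases p with _ | p <;> cases g <;> cases h <;> cases k <;>
          simp [modeCoef, modeBrk, SVbrk] <;> ring
    · rcases m with _ | m <;> cases g <;> cases h <;> cases k <;>
        simp [modeCoef, modeBrk, SVbrk] <;> first | ring1 | (ring_nf; simp)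
  · rcases n with _ | n <;> cases g <;> cases h <;> cases k <;>
      simp [modeCoef, modeBrk, SVbrk] <;> ring

lemma contr_lieAct (u v : Mode) (F : WordFun) :
    contr v (lieAct u F) = modeCoef u v • contr (modeBrk u v) F + lieAct u (contr v F) := rfl

lemma contr_wordD (u : Mode) (F : WordFun) :
    contr u (wordD F) = -lieAct u F - wordD (contr u F) := rfl

lemma contr_add (u : Mode) (F G : WordFun) : contr u (F + G) = contr u F + contr u G := rfl

lemma contr_smul (u : Mode) (r : ℂ) (F : WordFun) : contr u (r • F) = r • contr u F := rfl

lemma lieAct_add (u : Mode) (F G : WordFun) : lieAct u (F + G) = lieAct u F + lieAct u G := by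
  funext l
  induction l generalizing F G with
  | nil => simp [lieAct]
  | cons v l ih =>
    simp only [lieAct, contr_add, ih, Pi.add_apply]
    ring

lemma lieAct_smul (u : Mode) (r : ℂ) (F : WordFun) : lieAct u (r • F) = r • lieAct u F := by
  funext l
  induction l generalizing F with
  | nil => simp [lieAct]
  | cons v l ih =>
    simp only [lieAct, contr_smul, ih, Pi.smul_apply, smul_eq_mul]
    ring

lemma wordD_add (F G : WordFun) : wordD (F + G) = wordD F + wordD G := by
  funext l
  induction l generalizing F G with
  | nil => simp [wordD]
  | cons v l ih =>
    simp only [wordD, contr_add, ih, lieAct_add, Pi.add_apply]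
    ring

lemma wordD_smul (r : ℂ) (F : WordFun) : wordD (r • F) = r • wordD F := by
  funext l
  induction l generalizing F with
  | nil => simp [wordD]
  | cons v l ih =>
    simp only [wordD, contr_smul, ih, lieAct_smul, Pi.smul_apply, smul_eq_mul]
    ring

lemma wordD_neg (F : WordFun) : wordD (-F) = -wordD F := by simpa using wordD_smul (-1) F

lemma wordD_sub (F G : WordFun) : wordD (F - G) = wordD F - wordD G := by
  rw [sub_eq_add_neg, wordD_add, wordD_neg, ← sub_eq_add_neg]

lemma lieAct_neg (u : Mode) (F : WordFun) : lieAct u (-F) = -lieAct u F := by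
  simpa using lieAct_smul u (-1) F

lemma lieAct_sub (u : Mode) (F G : WordFun) : lieAct u (F - G) = lieAct u F - lieAct u G := by
  rw [sub_eq_add_neg, lieAct_add, lieAct_neg, ← sub_eq_add_neg]

lemma lieAct_comm (u v : Mode) (F : WordFun) :
    lieAct u (lieAct v F) - lieAct v (lieAct u F) =
      -(modeCoef u v • lieAct (modeBrk u v) F) := by
  funext l
  induction l generalizing F with
  | nil => simp [lieAct]
  | cons w l ih =>
    have h := ih (contr w F)
    have j := modeCoef_jacobi (fun x => F (x :: l)) u v w
    simp only [lieAct, contr_lieAct, lieAct_add, lieAct_smul, Pi.add_apply, Pi.sub_apply,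
      Pi.neg_apply, Pi.smul_apply, smul_eq_mul] at h ⊢
    linear_combination h + j

lemma lieAct_wordD (u : Mode) (F : WordFun) : lieAct u (wordD F) = wordD (lieAct u F) := by
  funext l
  induction l generalizing F with
  | nil => simp [lieAct, wordD]
  | cons v l ih =>
    have h := ih (contr v F)
    have j := congrFun (lieAct_comm u v F) l
    simp only [lieAct, wordD, contr_lieAct, contr_wordD, lieAct_sub, lieAct_neg, wordD_add,
      wordD_smul, Pi.add_apply, Pi.sub_apply, Pi.neg_apply, Pi.smul_apply, smul_eq_mul] at h j ⊢
    linear_combination -h - j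

lemma wordD_wordD (F : WordFun) : wordD (wordD F) = 0 := by
  funext l
  induction l generalizing F with
  | nil => simp [wordD]
  | cons u l ih =>
    have h := ih (contr u F)
    simp only [wordD, contr_wordD, wordD_sub, wordD_neg, lieAct_wordD, Pi.sub_apply,
      Pi.neg_apply, Pi.zero_apply] at h ⊢
    linear_combination h

lemma IsAlt.contr {F : WordFun} (hF : IsAlt F) (u : Mode) : IsAlt (contr u F) :=
  fun l₁ x y l₂ => hF (u :: l₁) x y l₂

lemma IsAlt.add {F G : WordFun} (hF : IsAlt F) (hG : IsAlt G) : IsAlt (F + G) := by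
  intro l₁ u v l₂
  simp only [Pi.add_apply, hF l₁ u v l₂, hG l₁ u v l₂]
  ring

lemma IsAlt.smul {F : WordFun} (hF : IsAlt F) (r : ℂ) : IsAlt (r • F) := by
  intro l₁ u v l₂
  simp [hF l₁ u v l₂]

lemma IsAlt.lieAct {F : WordFun} (hF : IsAlt F) (u : Mode) : IsAlt (lieAct u F) := by
  intro l₁ x y l₂
  induction l₁ generalizing F with
  | nil =>
    have h : ∀ x y, SVCA.contr x (SVCA.contr y F) = -SVCA.contr y (SVCA.contr x F) :=
      fun x y => funext fun l => hF [] y x l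
    have h1 := hF [] (modeBrk u x) y l₂
    have h2 := hF [] x (modeBrk u y) l₂
    simp only [List.nil_append, SVCA.lieAct, h y x, lieAct_neg, Pi.neg_apply] at h1 h2 ⊢
    simp only [SVCA.contr] at h1 h2 ⊢
    linear_combination modeCoef u x * h1 + modeCoef u y * h2
  | cons w l ih =>
    simp only [List.cons_append, SVCA.lieAct]
    rw [ih (hF.contr w), show F (modeBrk u w :: (l ++ x :: y :: l₂)) = _ from
      hF (modeBrk u w :: l) x y l₂]
    simp only [List.cons_append]
    ring

lemma IsAlt.wordD {F : WordFun} (hF : IsAlt F) : IsAlt (wordD F) := by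
  intro l₁ x y l₂
  induction l₁ generalizing F with
  | nil =>
    have h : SVCA.contr y (SVCA.contr x F) = -SVCA.contr x (SVCA.contr y F) :=
      funext fun l => hF [] x y l
    have j := modeCoef_skew (fun z => F (z :: l₂)) x y
    simp only [List.nil_append, SVCA.wordD, h, wordD_neg, Pi.neg_apply, SVCA.lieAct]
    linear_combination -j
  | cons w l ih =>
    simp only [List.cons_append, SVCA.wordD]
    rw [ih (hF.contr w), hF.lieAct w l x y l₂]
    ring

lemma wordD_eq_zero_of_length {F : WordFun} {q : ℕ} (hF : ∀ l, l.length = q → F l = 0) :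
    ∀ l : List Mode, l.length = q + 1 → wordD F l = 0 := by
  have act : ∀ (l : List Mode) (F : WordFun), (∀ l', l'.length = l.length → F l' = 0) →
      ∀ u, lieAct u F l = 0 := by
    intro l
    induction l with
    | nil => intros; rfl
    | cons v l ih =>
      intro F h u
      rw [lieAct, h (modeBrk u v :: l) rfl, ih (contr v F) (fun l' hl => h _ (by simp [hl]))]
      simp
  intro l
  induction l generalizing F q with
  | nil => intros; rfl
  | cons u l ih =>
    intro hl
    obtain rfl : l.length = q := by simpa using hl
    rw [wordD, act l F hF]
    cases l with
    | nil => simp [wordD]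
    | cons v l =>
      rw [ih (F := contr u F) (q := l.length) (fun l' h => hF _ (by simp [h])) rfl]
      simp

/-- Twice the conformal weight of a mode. -/
def modeWt : Mode → ℤ
  | (L, n) => 2 * n - 2
  | (Y, n) => 2 * n - 1
  | (M, n) => 2 * n

/-- Twice the conformal weight of a word. -/
def wordWt (l : List Mode) : ℤ := (l.map modeWt).sum

lemma wordWt_cons (u : Mode) (l : List Mode) : wordWt (u :: l) = modeWt u + wordWt l := by
  simp [wordWt]

/-- Multiplication of a word function by a function of the weight. -/
def wtScale (m : ℤ → ℂ) (F : WordFun) : WordFun := fun l => m (wordWt l) * F l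

lemma modeWt_modeBrk (u v : Mode) :
    modeCoef u v = 0 ∨ modeWt (modeBrk u v) = modeWt u + modeWt v := by
  obtain ⟨g, m⟩ := u
  obtain ⟨h, n⟩ := v
  rcases Nat.eq_zero_or_pos (m + n) with e | e
  · obtain ⟨rfl, rfl⟩ : m = 0 ∧ n = 0 := by omega
    left
    simp [modeCoef]
  · have e' : ((m + n - 1 : ℕ) : ℤ) = m + n - 1 := by omega
    cases g <;> cases h <;> simp only [modeCoef, modeBrk, SVbrk, modeWt, e'] <;>
      first
      | (left; ring1)
      | (right; ring1)

lemma contr_wtScale (m : ℤ → ℂ) (u : Mode) (F : WordFun) :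
    contr u (wtScale m F) = wtScale (fun k => m (modeWt u + k)) (contr u F) := by
  funext l
  simp [contr, wtScale, wordWt_cons]

lemma lieAct_wtScale (m : ℤ → ℂ) (u : Mode) (F : WordFun) :
    lieAct u (wtScale m F) = wtScale (fun k => m (modeWt u + k)) (lieAct u F) := by
  funext l
  induction l generalizing F m with
  | nil => simp [lieAct, wtScale]
  | cons v l ih =>
    have e : modeCoef u v * m (modeWt (modeBrk u v) + wordWt l) =
        modeCoef u v * m (modeWt u + (modeWt v + wordWt l)) := by
      rcases modeWt_modeBrk u v with h | h
      · simp [h]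
      · rw [h, add_assoc]
    simp only [lieAct, contr_wtScale, ih, wtScale, wordWt_cons] at e ⊢
    rw [add_left_comm (modeWt v)]
    linear_combination F (modeBrk u v :: l) * e

lemma wordD_wtScale (m : ℤ → ℂ) (F : WordFun) :
    wordD (wtScale m F) = wtScale m (wordD F) := by
  funext l
  induction l generalizing F m with
  | nil => simp [wordD, wtScale]
  | cons v l ih =>
    simp only [wordD, contr_wtScale, ih, lieAct_wtScale, wtScale, wordWt_cons]
    ring

lemma IsAlt.wtScale {F : WordFun} (hF : IsAlt F) (m : ℤ → ℂ) : IsAlt (wtScale m F) := by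
  intro l₁ u v l₂
  have e : wordWt (l₁ ++ u :: v :: l₂) = wordWt (l₁ ++ v :: u :: l₂) := by
    simp only [wordWt, List.map_append, List.map_cons, List.sum_append, List.sum_cons]
    ring
  simp only [SVCA.wtScale, e, hF l₁ u v l₂]
  ring

lemma lieAct_weight (F : WordFun) (l : List Mode) :
    lieAct (L, 1) F l = -((wordWt l : ℂ) / 2) * F l := by
  induction l generalizing F with
  | nil => simp [lieAct, wordWt]
  | cons v l ih =>
    obtain ⟨g, n⟩ := v
    rw [lieAct, ih, wordWt_cons]
    cases g <;> simp [modeCoef, modeBrk, SVbrk, modeWt, contr] <;> ring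

/-- A cocycle splits as its weight zero part plus an explicit coboundary. -/
lemma wordD_weight_homotopy {F : WordFun} (hF : wordD F = 0) :
    wordD (contr (L, 1) (wtScale (fun k => 2 / (k : ℂ)) F)) =
      F - wtScale (fun k => if k = 0 then 1 else 0) F := by
  funext l
  have h := congrFun (contr_wordD (L, 1) (wtScale (fun k => 2 / (k : ℂ)) F)) l
  have h0 : contr (L, 1) (wordD (wtScale (fun k => 2 / (k : ℂ)) F)) l = 0 := by
    rw [wordD_wtScale, hF]
    simp [contr, wtScale]
  rw [h0, Pi.sub_apply, Pi.neg_apply, lieAct_weight] at h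
  rw [Pi.sub_apply]
  rcases eq_or_ne (wordWt l) 0 with e | e
  · simp only [wtScale, e, Int.cast_zero, zero_div, neg_zero, zero_mul, zero_sub, if_true] at h ⊢
    linear_combination h
  · have e' : (wordWt l : ℂ) ≠ 0 := by exact_mod_cast e
    simp only [wtScale, if_neg e] at h ⊢
    field_simp at h
    linear_combination h

lemma IsAlt.eq_zero_of_perm {l l' : List Mode} (p : l.Perm l') {F : WordFun} (hF : IsAlt F)
    (h : F l' = 0) : F l = 0 := by
  induction p generalizing F with
  | nil => exact h
  | cons u _ ih => exact ih (hF.contr u) h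
  | swap u v l => exact (hF [] v u l).trans (by simpa using h)
  | trans _ _ ih₁ ih₂ => exact ih₁ hF (ih₂ hF h)

/-- The sorting key of a mode. -/
def modeKey : Mode → ℕ
  | (L, n) => 3 * n
  | (Y, n) => 3 * n + 1
  | (M, n) => 3 * n + 2

lemma modeKey_injective : Function.Injective modeKey := by
  rintro ⟨g, m⟩ ⟨h, n⟩ e
  cases g <;> cases h <;> simp only [modeKey, Prod.mk.injEq, reduceCtorEq, false_and, true_and] at e ⊢ <;>
    omega

/-- Insertion of a letter into a word together with the resulting sign, which is `0` if the letter
is met on the way. -/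
def signedInsert (u : Mode) : List Mode → ℤ × List Mode
  | [] => (1, [u])
  | v :: l =>
    if u = v then (0, v :: l)
    else if modeKey u < modeKey v then (1, u :: v :: l)
    else (-(signedInsert u l).1, v :: (signedInsert u l).2)

/-- Insertion sort together with the resulting sign, which is `0` if a letter is repeated. -/
def signedSort : List Mode → ℤ × List Mode
  | [] => (1, [])
  | u :: l =>
    ((signedSort l).1 * (signedInsert u (signedSort l).2).1, (signedInsert u (signedSort l).2).2)

/-- The word function with `F (signedSort l).2` at `l`, up to the sign. -/
def alternate (F : WordFun) : WordFun := fun l => (signedSort l).1 * F (signedSort l).2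

/-- The word function obtained by signed insertion of a letter. -/
def insertFun (u : Mode) (F : WordFun) : WordFun :=
  fun l => (signedInsert u l).1 * F (signedInsert u l).2

lemma insertFun_skew (u v : Mode) (F : WordFun) :
    insertFun v (insertFun u F) = -insertFun u (insertFun v F) := by
  have nil : ∀ (u : Mode) (F : WordFun), insertFun u F [] = F [u] := by
    simp [insertFun, signedInsert]
  have eq : ∀ (u : Mode) (F : WordFun) l, insertFun u F (u :: l) = 0 := by
    simp [insertFun, signedInsert]
  have lt : ∀ {u x : Mode} (F : WordFun) l, modeKey u < modeKey x →
      insertFun u F (x :: l) = F (u :: x :: l) := by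
    intro u x F l h
    have : u ≠ x := by rintro rfl; exact lt_irrefl _ h
    simp [insertFun, signedInsert, h, this]
  have gt : ∀ {u x : Mode} (F : WordFun) l, modeKey x < modeKey u →
      insertFun u F (x :: l) = -insertFun u (contr x F) l := by
    intro u x F l h
    have : u ≠ x := by rintro rfl; exact lt_irrefl _ h
    simp [insertFun, signedInsert, h.not_gt, this, contr]
  have contr_lt : ∀ {u x : Mode} (F : WordFun), modeKey u < modeKey x →
      contr x (insertFun u F) = contr x (contr u F) := fun F h => funext fun l => lt F l h
  have contr_gt : ∀ {u x : Mode} (F : WordFun), modeKey x < modeKey u →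
      contr x (insertFun u F) = -insertFun u (contr x F) := fun F h => funext fun l => gt F l h
  have contr_eq : ∀ (x : Mode) (F : WordFun), contr x (insertFun x F) = 0 :=
    fun x F => funext fun l => eq x F l
  have neg : ∀ (u : Mode) (F : WordFun), insertFun u (-F) = -insertFun u F := fun u F =>
    funext fun l => by simp [insertFun]
  have zero : ∀ (u : Mode), insertFun u 0 = 0 := fun u => funext fun l => by simp [insertFun]
  funext l
  induction l generalizing F with
  | nil =>
    simp only [nil, Pi.neg_apply]
    rcases lt_trichotomy (modeKey u) (modeKey v) with h | h | h
    · simp [lt _ _ h, gt _ _ h, nil, contr]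
    · obtain rfl := modeKey_injective h
      simp [eq]
    · simp [lt _ _ h, gt _ _ h, nil, contr]
  | cons x l ih =>
    simp only [Pi.neg_apply] at ih ⊢
    rcases lt_trichotomy (modeKey v) (modeKey x) with hv | hv | hv <;>
      rcases lt_trichotomy (modeKey u) (modeKey x) with hu | hu | hu
    · rw [lt _ _ hv, lt _ _ hu]
      rcases lt_trichotomy (modeKey u) (modeKey v) with h | h | h
      · rw [lt _ _ h, gt _ _ h, lt _ _ hv, contr, neg_neg]
      · obtain rfl := modeKey_injective h
        simp [eq]
      · rw [lt _ _ h, gt _ _ h, lt _ _ hu, contr]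
    · obtain rfl := modeKey_injective hu
      rw [lt _ _ hv, gt _ _ hv, eq, eq]
    · rw [lt _ _ hv, gt _ _ (hv.trans hu), gt _ _ hu, gt _ _ hu, contr_lt _ hv]
    · obtain rfl := modeKey_injective hv
      rw [lt _ _ hu, gt _ _ hu, eq, eq, neg_zero, neg_zero]
    · obtain rfl := modeKey_injective hv
      obtain rfl := modeKey_injective hu
      simp [eq]
    · obtain rfl := modeKey_injective hv
      rw [eq, gt _ _ hu, contr_eq, zero]
      simp
    · rw [lt _ _ hu, gt _ _ (hu.trans hv), gt _ _ hv, gt _ _ hv, contr_lt _ hu, neg_neg]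
    · obtain rfl := modeKey_injective hu
      rw [eq, gt _ _ hv, contr_eq, zero]
      simp
    · rw [gt _ _ hv, gt _ _ hu, contr_gt _ hu, contr_gt _ hv, neg, neg]
      simpa using ih (contr x F)

lemma IsAlt.apply_self {F : WordFun} (hF : IsAlt F) (u : Mode) (l : List Mode) :
    F (u :: u :: l) = 0 := by
  have := hF [] u u l
  simp only [List.nil_append] at this
  linear_combination this / 2

lemma IsAlt.insertFun_eq {F : WordFun} (hF : IsAlt F) (u : Mode) :
    insertFun u F = SVCA.contr u F := by
  funext l
  induction l generalizing F with
  | nil => simp [insertFun, signedInsert, SVCA.contr]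
  | cons v l ih =>
    simp only [insertFun, signedInsert]
    split_ifs with h h'
    · subst h
      simp [SVCA.contr, hF.apply_self]
    · simp [SVCA.contr]
    · have := ih (hF.contr v)
      simp only [insertFun, SVCA.contr] at this ⊢
      have h2 := hF [] u v l
      simp only [List.nil_append] at h2
      push_cast
      linear_combination -this - h2

lemma alternate_cons (F : WordFun) (u : Mode) (l : List Mode) :
    alternate F (u :: l) = alternate (insertFun u F) l := by
  simp [alternate, insertFun, signedSort, mul_assoc]

lemma IsAlt.alternate_eq {F : WordFun} (hF : IsAlt F) : alternate F = F := by
  funext l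
  induction l generalizing F with
  | nil => simp [alternate, signedSort]
  | cons u l ih => rw [alternate_cons, hF.insertFun_eq, ih (hF.contr u), SVCA.contr]

lemma isAlt_alternate (F : WordFun) : IsAlt (alternate F) := by
  intro l₁ u v l₂
  induction l₁ generalizing F with
  | nil =>
    simp only [List.nil_append, alternate_cons]
    rw [insertFun_skew]
    simp [alternate]
  | cons w l ih => rw [List.cons_append, List.cons_append, alternate_cons, alternate_cons, ih]

lemma signedInsert_perm (u : Mode) (l : List Mode) :
    (signedInsert u l).1 = 0 ∨ (signedInsert u l).2.Perm (u :: l) := by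
  induction l with
  | nil => simp [signedInsert]
  | cons v l ih =>
    simp only [signedInsert]
    split_ifs with h h'
    · simp
    · simp
    · rcases ih with ih | ih
      · simp [ih]
      · exact Or.inr ((ih.cons v).trans (List.Perm.swap u v l))

lemma signedSort_perm (l : List Mode) :
    (signedSort l).1 = 0 ∨ (signedSort l).2.Perm l := by
  induction l with
  | nil => simp [signedSort]
  | cons u l ih =>
    simp only [signedSort]
    rcases ih with ih | ih
    · simp [ih]
    · rcases signedInsert_perm u (signedSort l).2 with h | h
      · simp [h]
      · exact Or.inr (h.trans (ih.cons u))

/-- An alternating function vanishes on words with repeated letters. -/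
lemma IsAlt.eq_zero_of_not_nodup {F : WordFun} (hF : IsAlt F) {l : List Mode} (h : ¬ l.Nodup) :
    F l = 0 := by
  induction l generalizing F with
  | nil => simp at h
  | cons u l ih =>
    by_cases hu : u ∈ l
    · have p := (List.perm_cons_erase hu).cons u
      exact hF.eq_zero_of_perm p (hF.apply_self u _)
    · exact ih (hF.contr u) (fun hl => h (List.nodup_cons.mpr ⟨hu, hl⟩))

/-- Twice the structure constant of the bracket of two modes. -/
def intCoef : Mode → Mode → ℤ
  | (L, m), (L, n) => 2 * m - 2 * n
  | (L, m), (Y, n) => m - 2 * n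
  | (L, _), (M, n) => -2 * n
  | (Y, m), (L, n) => 2 * m - n
  | (Y, m), (Y, n) => 2 * m - 2 * n
  | (M, m), (L, _) => 2 * m
  | _, _ => 0

/-- The generator occurring in the bracket of two generators. -/
def genBrk : SVGen → SVGen → SVGen
  | L, g => g
  | Y, L => Y
  | Y, _ => M
  | M, _ => M

lemma intCoef_mul (f : Mode → ℂ) (u v : Mode) :
    2 * (modeCoef u v * f (modeBrk u v)) =
      intCoef u v * f (genBrk u.1 v.1, u.2 + v.2 - 1) := by
  obtain ⟨g, m⟩ := u
  obtain ⟨h, n⟩ := v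
  cases g <;> cases h <;> simp [modeCoef, modeBrk, SVbrk, intCoef, genBrk] <;> ring

/-- The value of a word function on a formal combination of words. -/
noncomputable def evalTerms (F : WordFun) (s : List (ℤ × List Mode)) : ℂ :=
  (s.map fun p => (p.1 : ℂ) * F p.2).sum

/-- The formal combination of words computing twice the action of a mode. -/
def actTerms (u : Mode) : List Mode → List (ℤ × List Mode)
  | [] => []
  | v :: l => (intCoef u v, (genBrk u.1 v.1, u.2 + v.2 - 1) :: l) ::
      (actTerms u l).map fun p => (p.1, v :: p.2)

/-- The formal combination of words computing twice the differential. -/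
def dTerms : List Mode → List (ℤ × List Mode)
  | [] => []
  | u :: l => ((actTerms u l).map fun p => (-p.1, p.2)) ++
      (dTerms l).map fun p => (-p.1, u :: p.2)

lemma evalTerms_cons (F : WordFun) (p : ℤ × List Mode) (s : List (ℤ × List Mode)) :
    evalTerms F (p :: s) = p.1 * F p.2 + evalTerms F s := rfl

lemma evalTerms_nil (F : WordFun) : evalTerms F [] = 0 := rfl

lemma evalTerms_append (F : WordFun) (s t : List (ℤ × List Mode)) :
    evalTerms F (s ++ t) = evalTerms F s + evalTerms F t := by
  simp [evalTerms]

lemma evalTerms_map_cons (F : WordFun) (u : Mode) (s : List (ℤ × List Mode)) :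
    evalTerms F (s.map fun p => (p.1, u :: p.2)) = evalTerms (contr u F) s := by
  simp [evalTerms, contr, Function.comp_def]

lemma evalTerms_map_neg (F : WordFun) (s : List (ℤ × List Mode)) :
    evalTerms F (s.map fun p => (-p.1, p.2)) = -evalTerms F s := by
  induction s with
  | nil => simp [evalTerms]
  | cons p s ih =>
    rw [List.map_cons, evalTerms_cons, evalTerms_cons, ih]
    push_cast
    ring

lemma two_mul_lieAct (F : WordFun) (u : Mode) (l : List Mode) :
    2 * lieAct u F l = evalTerms F (actTerms u l) := by
  induction l generalizing F with
  | nil => simp [lieAct, actTerms, evalTerms]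
  | cons v l ih =>
    rw [lieAct, actTerms, evalTerms_cons, evalTerms_map_cons, ← ih, mul_add,
      intCoef_mul (fun w => F (w :: l))]

lemma two_mul_wordD (F : WordFun) (l : List Mode) :
    2 * wordD F l = evalTerms F (dTerms l) := by
  induction l generalizing F with
  | nil => simp [wordD, dTerms, evalTerms]
  | cons u l ih =>
    have e : ((dTerms l).map fun p => (-p.1, u :: p.2)) =
        ((dTerms l).map fun p => (p.1, u :: p.2)).map fun p => (-p.1, p.2) := by
      simp [Function.comp_def]
    rw [wordD, dTerms, evalTerms_append, evalTerms_map_neg, e, evalTerms_map_neg,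
      evalTerms_map_cons, ← ih, ← two_mul_lieAct]
    ring

/-- Addition of a term to a formal combination of words. -/
def addTerm (c : ℤ) (l : List Mode) : List (ℤ × List Mode) → List (ℤ × List Mode)
  | [] => if c = 0 then [] else [(c, l)]
  | p :: s =>
    if p.2 = l then (if p.1 + c = 0 then s else (p.1 + c, l) :: s) else p :: addTerm c l s

/-- Sorting of all words in a formal combination. -/
def normTerms : List (ℤ × List Mode) → List (ℤ × List Mode)
  | [] => []
  | p :: s => addTerm (p.1 * (signedSort p.2).1) (signedSort p.2).2 (normTerms s)

lemma evalTerms_addTerm (F : WordFun) (c : ℤ) (l : List Mode) (s : List (ℤ × List Mode)) :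
    evalTerms F (addTerm c l s) = c * F l + evalTerms F s := by
  induction s with
  | nil =>
    rw [addTerm]
    split_ifs with h
    · simp [h, evalTerms]
    · simp [evalTerms]
  | cons p s ih =>
    rw [addTerm]
    split_ifs with h h'
    · have : (p.1 : ℂ) = -c := by
        rw [eq_neg_iff_add_eq_zero]
        exact_mod_cast h'
      rw [evalTerms_cons, h, this]
      ring
    · rw [evalTerms_cons, evalTerms_cons, h]
      push_cast
      ring
    · rw [evalTerms_cons, evalTerms_cons, ih]
      ring

lemma IsAlt.evalTerms_normTerms {F : WordFun} (hF : IsAlt F) (s : List (ℤ × List Mode)) :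
    evalTerms F (normTerms s) = evalTerms F s := by
  induction s with
  | nil => rfl
  | cons p s ih =>
    have h : ((signedSort p.2).1 : ℂ) * F (signedSort p.2).2 = F p.2 := congrFun hF.alternate_eq p.2
    rw [normTerms, evalTerms_addTerm, ih, evalTerms_cons, ← h]
    push_cast
    ring

/-- The mode `0` of `L`. -/
abbrev l0 : Mode := (L, 0)
/-- The mode `1` of `L`. -/
abbrev l1 : Mode := (L, 1)
/-- The mode `2` of `L`. -/
abbrev l2 : Mode := (L, 2)
/-- The mode `0` of `Y`. -/
abbrev y0 : Mode := (Y, 0)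
/-- The mode `1` of `Y`. -/
abbrev y1 : Mode := (Y, 1)
/-- The mode `2` of `Y`. -/
abbrev y2 : Mode := (Y, 2)
/-- The mode `0` of `M`. -/
abbrev m0 : Mode := (M, 0)
/-- The mode `1` of `M`. -/
abbrev m1 : Mode := (M, 1)

/-- The sorted words of weight zero without repeated letters, together with twice the differential
at these words. -/
def dTable : List (List Mode × List (ℤ × List Mode)) := [
  ([], []),
  ([m0], []),
  ([l1], []),
  ([l0, m1], [(2, [m0])]),
  ([l0, l2], [(4, [l1])]),
  ([y0, y1], [(2, [m0])]),
  ([m0, l1], []),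
  ([l0, y0, y2], [(-4, [l0, m1]), (4, [y0, y1])]),
  ([l0, m0, m1], []),
  ([l0, m0, l2], [(4, [m0, l1])]),
  ([l0, l1, m1], [(-2, [m0, l1])]),
  ([l0, l1, l2], []),
  ([y0, m0, y1], []),
  ([y0, l1, y1], [(-2, [m0, l1])]),
  ([l0, y0, m0, y2], [(-4, [l0, m0, m1]), (4, [y0, m0, y1])]),
  ([l0, y0, l1, y2], [(-4, [l0, l1, m1]), (4, [y0, l1, y1])]),
  ([l0, y0, y1, m1], [(-2, [l0, m0, m1]), (-2, [y0, m0, y1])]),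
  ([l0, y0, y1, l2], [(-2, [l0, m0, l2]), (-4, [y0, l1, y1])]),
  ([l0, m0, l1, m1], []),
  ([l0, m0, l1, l2], []),
  ([y0, m0, l1, y1], []),
  ([l0, y0, m0, l1, y2], [(-4, [l0, m0, l1, m1]), (4, [y0, m0, l1, y1])]),
  ([l0, y0, m0, y1, m1], []),
  ([l0, y0, m0, y1, l2], [(-4, [y0, m0, l1, y1])]),
  ([l0, y0, l1, y1, m1], [(2, [l0, m0, l1, m1]), (2, [y0, m0, l1, y1])]),
  ([l0, y0, l1, y1, l2], [(2, [l0, m0, l1, l2])]),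
  ([l0, y0, m0, l1, y1, m1], []),
  ([l0, y0, m0, l1, y1, l2], [])]

lemma dTable_normTerms : ∀ p ∈ dTable, normTerms (dTerms p.1) = p.2 := by decide +kernel

lemma dTable_signedSort : ∀ p ∈ dTable, signedSort p.1 = (1, p.1) := by decide +kernel

lemma dTable_powerset : ∀ s ∈ ({l0, l1, l2, y0, y1, y2, m0, m1} : Finset Mode).powerset,
    ∑ u ∈ s, modeWt u = 0 → ∃ p ∈ dTable, s = p.1.toFinset ∧ p.1.Nodup := by decide +kernel

lemma alternate_dTable (F : WordFun) : ∀ p ∈ dTable, alternate F p.1 = F p.1 := by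
  intro p hp
  simp [alternate, dTable_signedSort p hp]

lemma IsAlt.wordD_dTable {F : WordFun} (hF : IsAlt F) :
    ∀ p ∈ dTable, 2 * SVCA.wordD F p.1 = evalTerms F p.2 := by
  intro p hp
  rw [two_mul_wordD, ← dTable_normTerms p hp, hF.evalTerms_normTerms]

/-- In a word of weight zero without repeated letters the letters have weight at most `3 / 2`. -/
lemma mem_of_sum_modeWt {s : Finset Mode} (hs : ∑ u ∈ s, modeWt u = 0) {u : Mode} (hu : u ∈ s) :
    u ∈ ({l0, l1, l2, y0, y1, y2, m0, m1} : Finset Mode) := by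
  have neg : ∀ t : Finset Mode, -3 ≤ ∑ u ∈ t, modeWt u := by
    intro t
    have h1 : ∑ u ∈ t, modeWt u ≥
        ∑ u ∈ t, ((if u = l0 then -2 else 0) + if u = y0 then -1 else 0) := by
      refine Finset.sum_le_sum fun u _ => ?_
      obtain ⟨g, n⟩ := u
      cases g <;> simp only [modeWt, Prod.mk.injEq, reduceCtorEq, true_and, false_and, if_false] <;>
        (try split_ifs) <;> omega
    rw [Finset.sum_add_distrib, Finset.sum_ite_eq', Finset.sum_ite_eq'] at h1
    split_ifs at h1 <;> omega
  have h := neg (s.erase u)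
  rw [← Finset.add_sum_erase s modeWt hu] at hs
  obtain ⟨g, n⟩ := u
  have hL : ∀ n, modeWt (L, n) = 2 * n - 2 := fun _ => rfl
  have hY : ∀ n, modeWt (Y, n) = 2 * n - 1 := fun _ => rfl
  have hM : ∀ n, modeWt (M, n) = 2 * n := fun _ => rfl
  cases g <;> simp only [hL, hY, hM] at hs <;>
  · have : n ≤ 2 := by omega
    interval_cases n <;> first | (exfalso; omega) | decide

lemma exists_perm_dTable {w : List Mode} (hw : w.Nodup) (h0 : wordWt w = 0) :
    ∃ p ∈ dTable, w.Perm p.1 := by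
  have hs : ∑ u ∈ w.toFinset, modeWt u = 0 := by
    rw [List.sum_toFinset _ hw]
    exact h0
  obtain ⟨p, hp, e, hn⟩ := dTable_powerset w.toFinset
    (Finset.mem_powerset.mpr fun u hu => mem_of_sum_modeWt hs hu) hs
  exact ⟨p, hp, List.perm_of_nodup_nodup_toFinset_eq hw hn e⟩

/-- An alternating function is determined by the words of nonzero weight and by finitely many
further words. -/
lemma IsAlt.eq_of_dTable {F G : WordFun} (hF : IsAlt F) (hG : IsAlt G)
    (hw : ∀ w, wordWt w ≠ 0 → F w = G w) (ht : ∀ p ∈ dTable, F p.1 = G p.1) : F = G := by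
  have h : IsAlt (F + (-1 : ℂ) • G) := hF.add (hG.smul _)
  funext w
  suffices e : (F + (-1 : ℂ) • G) w = 0 by
    simpa [← sub_eq_add_neg, sub_eq_zero] using e
  by_cases h0 : wordWt w = 0
  · by_cases hn : w.Nodup
    · obtain ⟨p, hp, e⟩ := exists_perm_dTable hn h0
      exact h.eq_zero_of_perm e (by simp [ht p hp])
    · exact h.eq_zero_of_not_nodup hn
  · simp [hw w h0]

/-- A word function supported on words of weight zero. -/
def IsInvariant (F : WordFun) : Prop := ∀ w, wordWt w ≠ 0 → F w = 0

lemma IsInvariant.wordD {F : WordFun} (hF : IsInvariant F) : IsInvariant (wordD F) := by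
  have e : wtScale (fun k => if k = 0 then 1 else 0) F = F := by
    funext w
    by_cases h : wordWt w = 0 <;> simp [wtScale, h]
    exact (hF w h).symm
  intro w h
  rw [← e, wordD_wtScale]
  simp [wtScale, h]

lemma isInvariant_alternate {F : WordFun} (hF : IsInvariant F) : IsInvariant (alternate F) := by
  intro w h
  rcases signedSort_perm w with e | e
  · simp [alternate, e]
  · have : wordWt (signedSort w).2 = wordWt w := (e.map modeWt).sum_eq
    rw [alternate, hF _ (by rwa [this]), mul_zero]

/-- The words representing a basis of the cohomology. -/
def repWord : Fin 6 → List Mode :=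
  ![[], [l0, l1, l2], [l0, y0, m0, y1, m1], [l0, y0, m0, l1, y2], [l0, y0, m0, l1, y1, m1],
    [l0, y0, m0, l1, y1, l2]]

/-- The functionals on cocycles dual to the representatives. -/
def testTerms : Fin 6 → List (ℤ × List Mode) :=
  ![[(1, [])], [(1, [l0, l1, l2])], [(1, [l0, y0, m0, y1, m1])],
    [(1, [l0, y0, m0, l1, y2]), (2, [l0, y0, l1, y1, m1]), (2, [l0, y0, m0, y1, l2])],
    [(1, [l0, y0, m0, l1, y1, m1])], [(1, [l0, y0, m0, l1, y1, l2])]]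

/-- The degrees of the representatives. -/
def repLen : Fin 6 → ℕ := ![0, 3, 5, 5, 6, 6]

/-- The cocycle attached to a word. -/
noncomputable def repFun (i : Fin 6) : WordFun := alternate (Pi.single (repWord i) 1)

lemma wordWt_repWord (i : Fin 6) : wordWt (repWord i) = 0 := by
  revert i
  decide

lemma length_of_mem_testTerms : ∀ i, ∀ p ∈ testTerms i, p.2.length = repLen i := by
  decide

lemma wordWt_of_mem_testTerms : ∀ i, ∀ p ∈ testTerms i, wordWt p.2 = 0 := by
  decide +kernel

lemma signedSort_of_mem_testTerms : ∀ i, ∀ p ∈ testTerms i, signedSort p.2 = (1, p.2) := by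
  decide +kernel

lemma dTable_ne_repWord :
    ∀ i, ∀ p ∈ dTable, ∀ t ∈ p.2, t.2 ≠ repWord i ∧ signedSort t.2 = (1, t.2) := by
  decide +kernel

lemma evalTerms_congr {F G : WordFun} {s : List (ℤ × List Mode)} (h : ∀ p ∈ s, F p.2 = G p.2) :
    evalTerms F s = evalTerms G s := by
  unfold evalTerms
  congr 1
  exact List.map_congr_left fun p hp => by rw [h p hp]

lemma isAlt_repFun (i : Fin 6) : IsAlt (repFun i) := isAlt_alternate _

lemma isInvariant_repFun (i : Fin 6) : IsInvariant (repFun i) := by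
  refine isInvariant_alternate fun w h => ?_
  rw [Pi.single_apply, if_neg]
  rintro rfl
  exact h (wordWt_repWord i)

lemma evalTerms_repFun (i j : Fin 6) :
    evalTerms (repFun j) (testTerms i) = if i = j then 1 else 0 := by
  rw [evalTerms_congr (G := Pi.single (repWord j) 1) fun p hp => by
    rw [repFun, alternate, signedSort_of_mem_testTerms i p hp, Int.cast_one, one_mul]]
  fin_cases i <;> fin_cases j <;>
    simp [testTerms, repWord, evalTerms, Pi.single_apply]

lemma wordD_repFun (i : Fin 6) : wordD (repFun i) = 0 := by
  refine (isAlt_repFun i).wordD.eq_of_dTable (fun _ _ _ _ => by simp)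
    (fun w h => (isInvariant_repFun i).wordD w h) fun p hp => ?_
  have h := (isAlt_repFun i).wordD_dTable p hp
  rw [evalTerms_congr (G := 0) fun t ht => by
    obtain ⟨h1, h2⟩ := dTable_ne_repWord i p hp t ht
    rw [repFun, alternate, h2, Pi.single_apply, if_neg h1, mul_zero, Pi.zero_apply]] at h
  simpa [evalTerms] using h

lemma IsAlt.evalTerms_wordD {F : WordFun} (hF : IsAlt F) (i : Fin 6) :
    evalTerms (SVCA.wordD F) (testTerms i) = 0 := by
  have h := hF.wordD_dTable
  simp only [dTable, List.forall_mem_cons, evalTerms_cons, evalTerms_nil] at h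
  obtain ⟨h1, -, -, -, -, -, -, -, -, -, -, h12, -, -, -, -, -, -, -, -, -, h22, h23, h24, h25, -,
    h27, h28, -⟩ := h
  push_cast at *
  fin_cases i <;> simp [testTerms, evalTerms_cons, evalTerms_nil]
  · linear_combination h1 / 2
  · linear_combination h12 / 2
  · linear_combination h23 / 2
  · linear_combination h22 / 2 + h25 + h24
  · linear_combination h27 / 2
  · linear_combination h28 / 2

/-- The values on sorted words of a primitive of a cocycle of weight zero. -/
noncomputable def primitiveVal (F : WordFun) : WordFun := fun w =>
  if w = [l1] then F [l0, l2] / 2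
  else if w = [m0] then F [y0, y1]
  else if w = [m0, l1] then -F [l0, l1, m1]
  else if w = [y0, y1] then F [l0, y0, y2] / 2
  else if w = [l0, l1, m1] then -F [l0, y0, l1, y2] / 2
  else if w = [l0, m0, l2] then -F [l0, y0, y1, l2]
  else if w = [y0, m0, y1] then F [l0, y0, m0, y2] / 4 - F [l0, y0, y1, m1] / 2
  else if w = [l0, m0, m1] then -F [l0, y0, y1, m1] / 2 - F [l0, y0, m0, y2] / 4
  else if w = [y0, m0, l1, y1] then -F [l0, y0, m0, y1, l2] / 2
  else if w = [l0, m0, l1, m1] then F [l0, y0, l1, y1, m1] + F [l0, y0, m0, y1, l2] / 2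
  else if w = [l0, m0, l1, l2] then F [l0, y0, l1, y1, l2]
  else 0

lemma IsInvariant.ite {a : List Mode} (ha : wordWt a = 0) (c : ℂ) {F : WordFun}
    (hF : IsInvariant F) : IsInvariant fun w => if w = a then c else F w := by
  intro w h
  have e : w ≠ a := by
    rintro rfl
    exact h ha
  simpa [e] using hF w h

lemma isInvariant_primitiveVal (F : WordFun) : IsInvariant (primitiveVal F) := by
  unfold primitiveVal
  iterate 11 refine IsInvariant.ite (by decide) _ ?_
  exact fun _ _ => rfl

lemma IsAlt.wordD_primitive {F : WordFun} (hF : IsAlt F) (hi : IsInvariant F)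
    (hd : SVCA.wordD F = 0) (ht : ∀ i, evalTerms F (testTerms i) = 0) :
    SVCA.wordD (alternate (primitiveVal F)) = F := by
  refine (isAlt_alternate _).wordD.eq_of_dTable hF (fun w h => ?_) ?_
  · rw [hi w h, (isInvariant_alternate (isInvariant_primitiveVal F)).wordD w h]
  have h := hF.wordD_dTable
  rw [hd] at h
  have h0 := ht 0
  have t1 := ht 1
  have t2 := ht 2
  have t3 := ht 3
  have t4 := ht 4
  have t5 := ht 5
  have hg := (isAlt_alternate (primitiveVal F)).wordD_dTable
  have ha := alternate_dTable (primitiveVal F)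
  have e : ∀ p ∈ dTable, evalTerms (alternate (primitiveVal F)) p.2 =
      evalTerms (primitiveVal F) p.2 :=
    fun p hp => evalTerms_congr fun t ht => by
      rw [alternate, (dTable_ne_repWord 0 p hp t ht).2, Int.cast_one, one_mul]
  intro p hp
  refine mul_left_cancel₀ (two_ne_zero (α := ℂ)) ?_
  rw [hg p hp, e p hp]
  clear ha hg e
  revert p
  simp only [testTerms, evalTerms_cons, evalTerms_nil, Matrix.cons_val] at h0 t1 t2 t3 t4 t5
  simp only [dTable, List.forall_mem_cons, evalTerms_cons, evalTerms_nil, Pi.zero_apply] at h ⊢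
  obtain ⟨-, -, -, h4, h5, -, -, h8, -, h10, -, -, -, -, h15, h16, h17, h18, -, -, -, h22, -, h24,
    -, h26, -⟩ := h
  push_cast at *
  have v1 : primitiveVal F [l1] = F [l0, l2] / 2 := by simp [primitiveVal]
  have v2 : primitiveVal F [m0] = F [y0, y1] := by simp [primitiveVal]
  have v3 : primitiveVal F [m0, l1] = -F [l0, l1, m1] := by simp [primitiveVal]
  have v4 : primitiveVal F [y0, y1] = F [l0, y0, y2] / 2 := by simp [primitiveVal]
  have v5 : primitiveVal F [l0, l1, m1] = -F [l0, y0, l1, y2] / 2 := by simp [primitiveVal]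
  have v6 : primitiveVal F [l0, m0, l2] = -F [l0, y0, y1, l2] := by simp [primitiveVal]
  have v7 : primitiveVal F [y0, m0, y1] = F [l0, y0, m0, y2] / 4 - F [l0, y0, y1, m1] / 2 := by
    simp [primitiveVal]
  have v8 : primitiveVal F [l0, m0, m1] = -F [l0, y0, y1, m1] / 2 - F [l0, y0, m0, y2] / 4 := by
    simp [primitiveVal]
  have v9 : primitiveVal F [y0, m0, l1, y1] = -F [l0, y0, m0, y1, l2] / 2 := by
    simp [primitiveVal]
  have v10 : primitiveVal F [l0, m0, l1, m1] =
      F [l0, y0, l1, y1, m1] + F [l0, y0, m0, y1, l2] / 2 := by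
    simp [primitiveVal]
  have v11 : primitiveVal F [l0, m0, l1, l2] = F [l0, y0, l1, y1, l2] := by
    simp [primitiveVal]
  have v12 : primitiveVal F [l0, m1] = 0 := by simp [primitiveVal]
  have v13 : primitiveVal F [y0, l1, y1] = 0 := by simp [primitiveVal]
  simp only [v1, v2, v3, v4, v5, v6, v7, v8, v9, v10, v11, v12, v13]
  refine ⟨?_, ?_, ?_, ?_, ?_, ?_, ?_, ?_, ?_, ?_, ?_, ?_, ?_, ?_, ?_, ?_, ?_, ?_, ?_, ?_, ?_, ?_,
    ?_, ?_, ?_, ?_, ?_, ?_, by simp⟩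
  · linear_combination -2 * h0
  · linear_combination h4
  · linear_combination h5 / 2
  · linear_combination -h8 / 2
  · ring
  · ring
  · linear_combination h10 / 2
  · ring
  · linear_combination -h15 / 4 - h17 / 2
  · linear_combination -h16 - h18
  · ring
  · linear_combination -2 * t1
  · linear_combination h15 / 4 - h17 / 2
  · linear_combination h16 / 2
  · ring
  · ring
  · ring
  · ring
  · linear_combination -h22 / 2 - h24 / 2
  · linear_combination h26
  · linear_combination -h24 / 2
  · linear_combination -2 * t3
  · linear_combination -2 * t2
  · ring
  · ring
  · ring
  · linear_combination -2 * t4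
  · linear_combination -2 * t5

/-- On the words with given generators, the word function vanishes for large indices. -/
def Bdd (F : WordFun) : Prop :=
  ∀ a : List SVGen, ∃ N, ∀ w : List Mode, w.map Prod.fst = a → (∃ u ∈ w, N < u.2) → F w = 0

lemma Bdd.add {F G : WordFun} (hF : Bdd F) (hG : Bdd G) : Bdd (F + G) := by
  intro a
  obtain ⟨N, hN⟩ := hF a
  obtain ⟨N', hN'⟩ := hG a
  refine ⟨max N N', fun w hw ⟨u, hu, hn⟩ => ?_⟩
  rw [Pi.add_apply, hN w hw ⟨u, hu, (le_max_left _ _).trans_lt hn⟩,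
    hN' w hw ⟨u, hu, (le_max_right _ _).trans_lt hn⟩, add_zero]

lemma Bdd.contr {F : WordFun} (hF : Bdd F) (v : Mode) : Bdd (contr v F) := by
  intro a
  obtain ⟨N, hN⟩ := hF (v.1 :: a)
  exact ⟨N, fun w hw ⟨u, hu, hn⟩ => hN _ (by simp [hw]) ⟨u, List.mem_cons_of_mem _ hu, hn⟩⟩

lemma Bdd.wtScale {F : WordFun} (hF : Bdd F) (k : ℤ → ℂ) : Bdd (wtScale k F) := by
  intro a
  obtain ⟨N, hN⟩ := hF a
  exact ⟨N, fun w hw h => by rw [SVCA.wtScale, hN w hw h, mul_zero]⟩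

lemma IsAlt.bdd {F : WordFun} (hF : IsAlt F) (hi : IsInvariant F) : Bdd F := by
  refine fun a => ⟨2, fun w _ ⟨u, hu, hn⟩ => ?_⟩
  by_contra h
  have hw : w.Nodup := by_contra fun e => h (hF.eq_zero_of_not_nodup e)
  have h0 : wordWt w = 0 := by_contra fun e => h (hi w e)
  have := mem_of_sum_modeWt (s := w.toFinset) (by rwa [List.sum_toFinset _ hw])
    (List.mem_toFinset.mpr hu)
  have le : ∀ u ∈ ({l0, l1, l2, y0, y1, y2, m0, m1} : Finset Mode), u.2 ≤ 2 := by decide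
  exact hn.not_ge (le u this)

lemma IsInvariant.of_wtScale (F : WordFun) :
    IsInvariant (wtScale (fun k => if k = 0 then 1 else 0) F) := by
  intro w h
  simp [SVCA.wtScale, h]

/-- The cocycles killed by all functionals are coboundaries. -/
theorem IsAlt.exists_wordD_eq {F : WordFun} (hF : IsAlt F) (hb : Bdd F) (hd : SVCA.wordD F = 0)
    (ht : ∀ i, evalTerms F (testTerms i) = 0) :
    ∃ G, IsAlt G ∧ Bdd G ∧ SVCA.wordD G = F := by
  set F₀ := SVCA.wtScale (fun k => if k = 0 then 1 else 0) F with hF₀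
  have alt : IsAlt F₀ := hF.wtScale _
  have inv : IsInvariant F₀ := .of_wtScale F
  have hd₀ : SVCA.wordD F₀ = 0 := by
    rw [hF₀, wordD_wtScale, hd]
    funext w
    simp [SVCA.wtScale]
  have ht₀ : ∀ i, evalTerms F₀ (testTerms i) = 0 := fun i => by
    rw [← ht i]
    refine evalTerms_congr fun p hp => ?_
    simp [hF₀, SVCA.wtScale, wordWt_of_mem_testTerms i p hp]
  refine ⟨SVCA.contr (L, 1) (SVCA.wtScale (fun k => 2 / (k : ℂ)) F) + alternate (primitiveVal F₀),
    ((hF.wtScale _).contr _).add (isAlt_alternate _), ((hb.wtScale _).contr _).add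
      ((isAlt_alternate _).bdd (isInvariant_alternate (isInvariant_primitiveVal _))), ?_⟩
  rw [wordD_add, wordD_weight_homotopy hd, alt.wordD_primitive inv hd₀ ht₀, sub_add_cancel]

/-- The coefficient of a polynomial with respect to the divided power monomials. -/
noncomputable def ncoef {q : ℕ} (p : MvPolynomial (Fin q) ℂ) (n : Fin q → ℕ) : ℂ :=
  ((∏ i, (n i).factorial : ℕ) : ℂ) * coeff (Finsupp.equivFunOnFinite.symm n) p

lemma ncoef_add {q : ℕ} (p p' : MvPolynomial (Fin q) ℂ) (n : Fin q → ℕ) :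
    ncoef (p + p') n = ncoef p n + ncoef p' n := by
  simp [ncoef, mul_add]

lemma ncoef_C_mul {q : ℕ} (r : ℂ) (p : MvPolynomial (Fin q) ℂ) (n : Fin q → ℕ) :
    ncoef (C r * p) n = r * ncoef p n := by
  simp [ncoef, coeff_C_mul]
  ring

lemma ncoef_smul {q : ℕ} (r : ℂ) (p : MvPolynomial (Fin q) ℂ) (n : Fin q → ℕ) :
    ncoef (r • p) n = r * ncoef p n := by
  rw [smul_eq_C_mul, ncoef_C_mul]

lemma ncoef_zero {q : ℕ} (n : Fin q → ℕ) : ncoef (0 : MvPolynomial (Fin q) ℂ) n = 0 := by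
  simp [ncoef]

lemma ncoef_sub {q : ℕ} (p p' : MvPolynomial (Fin q) ℂ) (n : Fin q → ℕ) :
    ncoef (p - p') n = ncoef p n - ncoef p' n := by
  simp [ncoef, mul_sub]

lemma ncoef_sum {q : ℕ} {ι : Type*} (s : Finset ι) (p : ι → MvPolynomial (Fin q) ℂ)
    (n : Fin q → ℕ) : ncoef (∑ i ∈ s, p i) n = ∑ i ∈ s, ncoef (p i) n := by
  simp [ncoef, coeff_sum, Finset.mul_sum]

lemma ncoef_C {q : ℕ} (r : ℂ) (n : Fin q → ℕ) :
    ncoef (C r) n = if ∀ i, n i = 0 then r else 0 := by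
  have e : 0 = Finsupp.equivFunOnFinite.symm n ↔ ∀ i, n i = 0 := by
    rw [eq_comm, DFunLike.ext_iff]
    rfl
  rw [ncoef, coeff_C]
  simp only [e]
  split_ifs with h
  · simp [h]
  · simp

lemma ncoef_mul_X {q : ℕ} (p : MvPolynomial (Fin q) ℂ) (i : Fin q) (n : Fin q → ℕ) :
    ncoef (p * X i) n = n i * ncoef p (Function.update n i (n i - 1)) := by
  rw [ncoef, coeff_mul_X']
  by_cases h : n i = 0
  · simp [h]
  · have hs : i ∈ (Finsupp.equivFunOnFinite.symm n).support := by simpa using h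
    have e : Finsupp.equivFunOnFinite.symm n - Finsupp.single i 1 =
        Finsupp.equivFunOnFinite.symm (Function.update n i (n i - 1)) := by
      ext k
      rcases eq_or_ne k i with rfl | hk
      · simp
      · simp [hk]
    have f : ∏ k, (n k).factorial =
        n i * ∏ k, (Function.update n i (n i - 1) k).factorial := by
      rw [← Finset.mul_prod_erase _ _ (Finset.mem_univ i),
        ← Finset.mul_prod_erase Finset.univ (fun k => (Function.update n i (n i - 1) k).factorial)
          (Finset.mem_univ i), Function.update_self, ← mul_assoc,
        Nat.mul_factorial_pred h]
      congr 1
      refine Finset.prod_congr rfl fun k hk => ?_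
      rw [Function.update_of_ne (Finset.ne_of_mem_erase hk)]
    rw [if_pos hs, e, f, ncoef]
    push_cast
    ring

lemma ncoef_injective {q : ℕ} {p p' : MvPolynomial (Fin q) ℂ}
    (h : ∀ n, ncoef p n = ncoef p' n) : p = p' := by
  ext n
  have := h n
  have e : Finsupp.equivFunOnFinite.symm (n : Fin q → ℕ) = n := by
    ext
    simp
  simp only [ncoef, e] at this
  refine mul_left_cancel₀ ?_ this
  exact_mod_cast (Finset.prod_pos fun i _ => Nat.factorial_pos (n i)).ne'

lemma ncoef_rename {q : ℕ} (σ : Equiv.Perm (Fin q)) (p : MvPolynomial (Fin q) ℂ)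
    (n : Fin q → ℕ) : ncoef (rename σ p) n = ncoef p (n ∘ σ) := by
  induction p using MvPolynomial.induction_on generalizing n with
  | C r =>
    rw [rename_C, ncoef_C, ncoef_C]
    congr 1
    exact propext ⟨fun h i => h _, fun h i => by simpa using h (σ.symm i)⟩
  | add p p' ih ih' => rw [map_add, ncoef_add, ih, ih', ncoef_add]
  | mul_X p k ih =>
    rw [map_mul, rename_X, ncoef_mul_X, ih, ncoef_mul_X]
    congr 2
    exact Function.update_comp_eq_of_injective _ σ.injective _ _

lemma ncoef_aeval_cons_zero {q : ℕ} (p : MvPolynomial (Fin (q + 1)) ℂ) (n : Fin q → ℕ) :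
    ncoef (aeval (Fin.cons 0 X : Fin (q + 1) → MvPolynomial (Fin q) ℂ) p) n =
      ncoef p (Fin.cons 0 n) := by
  induction p using MvPolynomial.induction_on generalizing n with
  | C r =>
    rw [aeval_C, algebraMap_eq, ncoef_C, ncoef_C]
    simp [Fin.forall_fin_succ]
  | add p p' ih ih' => rw [map_add, ncoef_add, ih, ih', ncoef_add]
  | mul_X p k ih =>
    rw [map_mul, aeval_X]
    cases k using Fin.cases with
    | zero => simp [ncoef_mul_X, ncoef_zero]
    | succ k => rw [Fin.cons_succ, ncoef_mul_X, ih, ncoef_mul_X, Fin.cons_succ, Fin.cons_update]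

lemma ncoef_aeval_cons_add {q r : ℕ} (p : MvPolynomial (Fin (q + 1)) ℂ) {i j : Fin r}
    {s : Fin q → Fin r} (hij : i ≠ j) (hs : Function.Injective s) (hi : ∀ k, s k ≠ i)
    (hj : ∀ k, s k ≠ j) (h : ∀ x, x = i ∨ x = j ∨ ∃ k, x = s k) (n : Fin r → ℕ) :
    ncoef (aeval (Fin.cons (X i + X j) fun k => X (s k) :
      Fin (q + 1) → MvPolynomial (Fin r) ℂ) p) n =
      ncoef p (Fin.cons (n i + n j) (n ∘ s)) := by
  induction p using MvPolynomial.induction_on generalizing n with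
  | C r =>
    rw [aeval_C, algebraMap_eq, ncoef_C, ncoef_C]
    congr 1
    refine propext ⟨fun e k => ?_, fun e x => ?_⟩
    · cases k using Fin.cases <;> simp [e]
    · have e0 := e 0
      rw [Fin.cons_zero, Nat.add_eq_zero_iff] at e0
      rcases h x with rfl | rfl | ⟨k, rfl⟩
      · exact e0.1
      · exact e0.2
      · simpa using e k.succ
  | add p p' ih ih' => rw [map_add, ncoef_add, ih, ih', ncoef_add]
  | mul_X p k ih =>
    rw [map_mul, aeval_X]
    cases k using Fin.cases with
    | zero =>
      have ei : ∀ x, Function.update n i x ∘ s = n ∘ s := fun x => by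
        funext k
        simp [hi k]
      have ej : ∀ x, Function.update n j x ∘ s = n ∘ s := fun x => by
        funext k
        simp [hj k]
      rw [Fin.cons_zero, mul_add, ncoef_add, ncoef_mul_X, ncoef_mul_X, ih, ih, ncoef_mul_X,
        ei, ej, Function.update_self, Function.update_self, Function.update_of_ne hij,
        Function.update_of_ne hij.symm, Fin.cons_zero, Fin.update_cons_zero]
      rcases Nat.eq_zero_or_pos (n i) with h0 | h0 <;> rcases Nat.eq_zero_or_pos (n j) with h1 | h1
      · simp [h0, h1]
      · simp [h0]
      · simp [h1]
      · rw [show n i - 1 + n j = n i + n j - 1 by omega,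
            show n i + (n j - 1) = n i + n j - 1 by omega]
        push_cast
        ring
    | succ k =>
      rw [Fin.cons_succ, ncoef_mul_X, ih, ncoef_mul_X, Fin.cons_succ,
        Function.update_of_ne (hi k).symm, Function.update_of_ne (hj k).symm,
        Function.update_comp_eq_of_injective _ hs, ← Fin.cons_update]
      rfl

lemma SVskip_def {q : ℕ} {i j : Fin (q + 2)} (h : i < j) :
    ∃ i' : Fin (q + 1), j.succAbove i' = i ∧ ∀ k, SVskip i j k = j.succAbove (i'.succAbove k) := by
  have hi : (i : ℕ) < q + 1 := by omega
  refine ⟨⟨min (i : ℕ) q, Nat.lt_succ_of_le (Nat.min_le_right _ _)⟩, ?_, fun k => rfl⟩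
  have e : (⟨min (i : ℕ) q, Nat.lt_succ_of_le (Nat.min_le_right _ _)⟩ : Fin (q + 1)) =
      i.castLT hi := by
    ext
    simp only [Fin.val_castLT]
    omega
  rw [e, Fin.succAbove_of_castSucc_lt _ _ (by simpa using h), Fin.castSucc_castLT]

lemma SVskip_injective {q : ℕ} {i j : Fin (q + 2)} (h : i < j) :
    Function.Injective (SVskip i j) := by
  obtain ⟨i', -, e⟩ := SVskip_def h
  intro k k' hk
  rw [e, e] at hk
  exact Fin.succAbove_right_injective (Fin.succAbove_right_injective hk)

lemma SVskip_ne_left {q : ℕ} {i j : Fin (q + 2)} (h : i < j) (k : Fin q) : SVskip i j k ≠ i := by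
  obtain ⟨i', e', e⟩ := SVskip_def h
  rw [e, ← e']
  exact fun hk => Fin.succAbove_ne _ _ (Fin.succAbove_right_injective hk)

lemma SVskip_ne_right {q : ℕ} {i j : Fin (q + 2)} (k : Fin q) : SVskip i j k ≠ j :=
  Fin.succAbove_ne _ _

lemma SVskip_cover {q : ℕ} {i j : Fin (q + 2)} (h : i < j) (x : Fin (q + 2)) :
    x = i ∨ x = j ∨ ∃ k, x = SVskip i j k := by
  obtain ⟨i', e', e⟩ := SVskip_def h
  rcases eq_or_ne x j with hx | hx
  · exact Or.inr (Or.inl hx)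
  · obtain ⟨z, rfl⟩ := Fin.exists_succAbove_eq hx
    rcases eq_or_ne z i' with rfl | hz
    · exact Or.inl e'
    · obtain ⟨k, rfl⟩ := Fin.exists_succAbove_eq hz
      exact Or.inr (Or.inr ⟨k, (e k).symm⟩)

lemma SVskip_zero_succ {q : ℕ} (j : Fin (q + 2)) (k : Fin (q + 1)) :
    SVskip 0 j.succ k = (j.succAbove k).succ := by
  have e : (⟨min ((0 : Fin (q + 3)) : ℕ) (q + 1), Nat.lt_succ_of_le (Nat.min_le_right _ _)⟩ :
      Fin (q + 2)) = 0 := by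
    ext
    simp
  rw [SVskip, e, Fin.zero_succAbove, Fin.succ_succAbove_succ]

lemma SVskip_succ_succ_zero {q : ℕ} (i j : Fin (q + 2)) :
    SVskip (q := q + 1) i.succ j.succ 0 = 0 := by
  rw [SVskip, Fin.succAbove_ne_zero_zero, Fin.succAbove_ne_zero_zero]
  · exact Fin.succ_ne_zero _
  · intro h
    simpa using congrArg Fin.val h

lemma SVskip_succ_succ_succ {q : ℕ} (i j : Fin (q + 2)) (k : Fin q) :
    SVskip i.succ j.succ k.succ = (SVskip i j k).succ := by
  have e : (⟨min (i.succ : ℕ) (q + 1), Nat.lt_succ_of_le (Nat.min_le_right _ _)⟩ : Fin (q + 2)) =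
      (⟨min (i : ℕ) q, Nat.lt_succ_of_le (Nat.min_le_right _ _)⟩ : Fin (q + 1)).succ := by
    ext
    simp
  rw [SVskip, SVskip, e, Fin.succ_succAbove_succ, Fin.succ_succAbove_succ]

/-- The coefficients of a cochain, indexed by tuples of modes. -/
noncomputable def modeCoeff {q : ℕ} (c : SVRaw q) (w : Fin q → Mode) : ℂ :=
  ncoef (c fun i => (w i).1) fun i => (w i).2

lemma modeCoeff_SVdTerm {q : ℕ} (c : SVRaw (q + 1)) (w : Fin (q + 2) → Mode) {i j : Fin (q + 2)}
    (h : i < j) :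
    ncoef (SVdTerm c (fun i => (w i).1) i j) (fun i => (w i).2) =
      (-1) ^ (i + j : ℕ) * (modeCoef (w i) (w j) *
        modeCoeff c (Fin.cons (modeBrk (w i) (w j)) fun k => w (SVskip i j k))) := by
  rw [SVdTerm, ncoef_smul]
  congr 1
  set P := c (Fin.cons (SVbrk (w i).1 (w j).1).1 fun k => (w (SVskip i j k)).1) with hP
  have key : ∀ n : Fin (q + 2) → ℕ, ncoef (aeval (Fin.cons (X i + X j) fun k => X (SVskip i j k) :
      Fin (q + 1) → MvPolynomial (Fin (q + 2)) ℂ) P) n =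
      ncoef P (Fin.cons (n i + n j) (n ∘ SVskip i j)) :=
    ncoef_aeval_cons_add P h.ne (SVskip_injective h) (SVskip_ne_left h) SVskip_ne_right
      (SVskip_cover h)
  set A := aeval (Fin.cons (X i + X j) fun k => X (SVskip i j k) :
      Fin (q + 1) → MvPolynomial (Fin (q + 2)) ℂ) P with hA
  have e : modeCoeff c (Fin.cons (modeBrk (w i) (w j)) fun k => w (SVskip i j k)) =
      ncoef P (Fin.cons ((w i).2 + (w j).2 - 1) fun k => (w (SVskip i j k)).2) := by
    rw [modeCoeff, hP]
    congr 2
    · funext k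
      cases k using Fin.cases <;> rfl
    · funext k
      cases k using Fin.cases <;> rfl
  have ei : ∀ (n : Fin (q + 2) → ℕ) x, Function.update n i x ∘ SVskip i j = n ∘ SVskip i j :=
    fun n x => by
      funext k
      simp [SVskip_ne_left h k]
  have ej : ∀ (n : Fin (q + 2) → ℕ) x, Function.update n j x ∘ SVskip i j = n ∘ SVskip i j :=
    fun n x => by
      funext k
      simp [SVskip_ne_right k]
  rw [e, sub_mul, mul_assoc, mul_assoc, add_mul, ncoef_sub, ncoef_C_mul, ncoef_C_mul, ncoef_add,
    mul_comm (X i), mul_comm (X j), ncoef_mul_X, ncoef_mul_X, key, key, ei, ej,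
    Function.update_self, Function.update_self, Function.update_of_ne h.ne,
    Function.update_of_ne h.ne', modeCoef]
  generalize (w i).2 = a
  generalize (w j).2 = b
  have r : ((fun i => (w i).2) ∘ SVskip i j) = fun k => (w (SVskip i j k)).2 := rfl
  rw [r]
  rcases Nat.eq_zero_or_pos a with h0 | h0 <;> rcases Nat.eq_zero_or_pos b with h1 | h1
  · simp [h0, h1]
  · simp [h0]
    ring
  · simp [h1]
    ring
  · rw [show a - 1 + b = a + b - 1 by omega, show a + (b - 1) = a + b - 1 by omega]
    ring

lemma IsAlt.swap {F : WordFun} (hF : IsAlt F) (u v : Mode) (w : List Mode) :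
    F (u :: v :: w) = -F (v :: u :: w) := hF [] u v w

lemma IsAlt.lieAct_ofFn {F : WordFun} (hF : IsAlt F) (u : Mode) {n : ℕ} (w : Fin (n + 1) → Mode) :
    SVCA.lieAct u F (List.ofFn w) = ∑ j : Fin (n + 1), (-1) ^ (j : ℕ) *
      (modeCoef u (w j) * F (modeBrk u (w j) :: List.ofFn fun k => w (j.succAbove k))) := by
  induction n generalizing F with
  | zero => simp [SVCA.lieAct]
  | succ n ih =>
    rw [Fin.sum_univ_succ, List.ofFn_succ, SVCA.lieAct, ih (hF.contr _), ← sub_eq_zero]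
    simp only [Fin.val_zero, pow_zero, one_mul, Fin.zero_succAbove, Fin.val_succ, pow_succ]
    rw [add_sub_add_left_eq_sub, ← Finset.sum_sub_distrib]
    refine Finset.sum_eq_zero fun j _ => ?_
    rw [List.ofFn_succ (f := fun k => w (j.succ.succAbove k)), Fin.succ_succAbove_zero,
      hF.swap, SVCA.contr]
    simp only [Fin.succ_succAbove_succ]
    ring

lemma IsAlt.wordD_ofFn {F : WordFun} (hF : IsAlt F) {q : ℕ} (w : Fin (q + 2) → Mode) :
    SVCA.wordD F (List.ofFn w) = ∑ i : Fin (q + 2), ∑ j : Fin (q + 2),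
      if (i : ℕ) < j then (-1) ^ (i + j : ℕ) * (modeCoef (w i) (w j) *
        F (modeBrk (w i) (w j) :: List.ofFn fun k => w (SVskip i j k))) else 0 := by
  induction q generalizing F with
  | zero =>
    simp [Fin.sum_univ_succ, SVCA.wordD, SVCA.lieAct]
  | succ q ih =>
    conv_rhs => rw [Fin.sum_univ_succ, Fin.sum_univ_succ, if_neg (by simp), zero_add]
    rw [List.ofFn_succ, SVCA.wordD, ih (hF.contr _), hF.lieAct_ofFn, sub_eq_add_neg,
      ← Finset.sum_neg_distrib, ← Finset.sum_neg_distrib]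
    congr 1
    · refine Finset.sum_congr rfl fun j _ => ?_
      rw [if_pos (by simp)]
      simp only [SVskip_zero_succ, Fin.val_zero, Fin.val_succ, zero_add, pow_succ]
      ring
    · refine Finset.sum_congr rfl fun i _ => ?_
      conv_rhs => rw [Fin.sum_univ_succ, if_neg (by simp), zero_add]
      rw [← Finset.sum_neg_distrib]
      refine Finset.sum_congr rfl fun j _ => ?_
      simp only [Fin.val_succ, add_lt_add_iff_right]
      split_ifs with h
      · rw [List.ofFn_succ (f := fun k => w (SVskip i.succ j.succ k)), SVskip_succ_succ_zero,
          hF.swap, SVCA.contr]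
        simp only [SVskip_succ_succ_succ]
        ring
      · simp

lemma modeCoeff_add {q : ℕ} (c c' : SVRaw q) (w : Fin q → Mode) :
    modeCoeff (c + c') w = modeCoeff c w + modeCoeff c' w := ncoef_add _ _ _

lemma modeCoeff_smul {q : ℕ} (r : ℂ) (c : SVRaw q) (w : Fin q → Mode) :
    modeCoeff (r • c) w = r * modeCoeff c w := ncoef_smul _ _ _

lemma modeCoeff_injective {q : ℕ} {c c' : SVRaw q} (h : ∀ w, modeCoeff c w = modeCoeff c' w) :
    c = c' :=
  funext fun a => ncoef_injective fun n => h fun i => (a i, n i)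

/-- The word function of a cochain. -/
noncomputable def toWord (q : ℕ) : SVRaw q →ₗ[ℂ] WordFun where
  toFun c w := if h : w.length = q then modeCoeff c fun i => w.get (i.cast h.symm) else 0
  map_add' c c' := by
    funext w
    by_cases h : w.length = q <;> simp [h, modeCoeff_add]
  map_smul' r c := by
    funext w
    by_cases h : w.length = q <;> simp [h, modeCoeff_smul]

lemma exists_eq_ofFn {q : ℕ} {l : List Mode} (h : l.length = q) :
    ∃ w : Fin q → Mode, l = List.ofFn w := by
  subst h
  exact ⟨l.get, (List.ofFn_get l).symm⟩

lemma toWord_ofFn {q : ℕ} (c : SVRaw q) (w : Fin q → Mode) :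
    toWord q c (List.ofFn w) = modeCoeff c w := by
  simp [toWord]

lemma toWord_of_length_ne {q : ℕ} (c : SVRaw q) {l : List Mode} (h : l.length ≠ q) :
    toWord q c l = 0 := by
  simp [toWord, h]

lemma toWord_eq_of {q : ℕ} (c : SVRaw q) {F : WordFun} (h : ∀ w, modeCoeff c w = F (List.ofFn w))
    (h' : ∀ l : List Mode, l.length ≠ q → F l = 0) : toWord q c = F := by
  funext l
  by_cases e : l.length = q
  · obtain ⟨w, rfl⟩ := exists_eq_ofFn e
    rw [toWord_ofFn, h]
  · rw [toWord_of_length_ne c e, h' l e]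

lemma toWord_injective (q : ℕ) : Function.Injective (toWord q) := fun c c' h =>
  modeCoeff_injective fun w => by rw [← toWord_ofFn, h, toWord_ofFn]

lemma bdd_toWord {q : ℕ} (c : SVRaw q) : Bdd (toWord q c) := by
  intro a
  by_cases h : a.length = q
  · subst h
    refine ⟨(c a.get).totalDegree, fun l hl ⟨u, hu, hn⟩ => ?_⟩
    obtain ⟨w, rfl⟩ := exists_eq_ofFn (show l.length = a.length by rw [← hl, List.length_map])
    have e : (fun i => (w i).1) = a.get := by
      apply List.ofFn_injective
      rw [List.ofFn_get]
      rw [List.map_ofFn] at hl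
      exact hl
    obtain ⟨i, rfl⟩ := List.mem_ofFn.mp hu
    rw [toWord_ofFn, modeCoeff, e, ncoef, coeff_eq_zero_of_totalDegree_lt, mul_zero]
    refine hn.trans_le ?_
    have := Finset.single_le_sum (f := fun i => (w i).2) (fun _ _ => Nat.zero_le _)
      (Finset.mem_univ i)
    refine this.trans (le_of_eq ?_)
    symm
    refine Finset.sum_subset (Finset.subset_univ _) fun k _ hk => ?_
    simpa using hk
  · exact ⟨0, fun l hl _ => toWord_of_length_ne c fun e => h (by rw [← hl, List.length_map, e])⟩

lemma Bdd.exists_modeCoeff {F : WordFun} (hF : Bdd F) (q : ℕ) :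
    ∃ c : SVRaw q, ∀ w : Fin q → Mode, modeCoeff c w = F (List.ofFn w) := by
  choose N hN using hF
  refine ⟨fun a => ∑ n ∈ Fintype.piFinset fun _ => Finset.range (N (List.ofFn a) + 1),
    monomial (Finsupp.equivFunOnFinite.symm n)
      (F (List.ofFn fun i => (a i, n i)) / ((∏ i, (n i).factorial : ℕ) : ℂ)), fun w => ?_⟩
  have f : ((∏ i, (w i).2.factorial : ℕ) : ℂ) ≠ 0 := by
    exact_mod_cast (Finset.prod_pos fun i _ => Nat.factorial_pos (w i).2).ne'
  simp only [modeCoeff, ncoef, coeff_sum, coeff_monomial, EmbeddingLike.apply_eq_iff_eq,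
    Finset.sum_ite_eq']
  split_ifs with h
  · field_simp
  · rw [mul_zero, eq_comm]
    refine hN (List.ofFn fun i => (w i).1) _ (by rw [List.map_ofFn]; rfl) ?_
    by_contra! e
    refine h (Fintype.mem_piFinset.mpr fun i => Finset.mem_range.mpr ?_)
    exact Nat.lt_succ_of_le (e _ (List.mem_ofFn.mpr ⟨i, rfl⟩))

lemma mem_SVCochain_iff {q : ℕ} {c : SVRaw q} : c ∈ SVCochain q ↔
    ∀ (σ : Equiv.Perm (Fin q)) (w : Fin q → Mode),
      modeCoeff c (w ∘ σ) = ((Equiv.Perm.sign σ : ℤ) : ℂ) * modeCoeff c w := by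
  constructor
  · intro h σ w
    have := congrArg (fun p => ncoef p fun i => (w i).2) (h σ fun i => (w i).1)
    simp only [ncoef_rename, ncoef_smul] at this
    exact this
  · intro h σ a
    refine ncoef_injective fun n => ?_
    rw [ncoef_rename, ncoef_smul]
    exact h σ fun i => (a i, n i)

lemma ofFn_comp_swap {q : ℕ} {w : Fin q → Mode} {l₁ l₂ : List Mode} {u v : Mode}
    (h : List.ofFn w = l₁ ++ u :: v :: l₂) {i j : Fin q} (hi : (i : ℕ) = l₁.length)
    (hj : (j : ℕ) = l₁.length + 1) :
    List.ofFn (w ∘ Equiv.swap i j) = l₁ ++ v :: u :: l₂ := by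
  have hw : ∀ k : Fin q, w k = (l₁ ++ u :: v :: l₂)[(k : ℕ)]'(by
      rw [← h, List.length_ofFn]; exact k.2) := fun k => by
    simp [← h]
  have hl : q = l₁.length + (l₂.length + 1 + 1) := by
    simpa using congrArg List.length h
  refine List.ext_getElem (by simp; omega) fun k h1 h2 => ?_
  rw [List.getElem_ofFn, Function.comp_apply, hw]
  have hk : k < q := by simpa using h1
  rcases eq_or_ne k i with e | e
  · have : (⟨k, hk⟩ : Fin q) = i := Fin.ext e
    rw [this, Equiv.swap_apply_left]
    simp [hj, e, hi]
  · rcases eq_or_ne k j with e' | e'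
    · have : (⟨k, hk⟩ : Fin q) = j := Fin.ext e'
      rw [this, Equiv.swap_apply_right]
      simp [hj, e', hi]
    · rw [Equiv.swap_apply_of_ne_of_ne (fun t => e (congrArg Fin.val t))
        (fun t => e' (congrArg Fin.val t))]
      rcases lt_or_ge k l₁.length with hlt | hge
      · simp [hlt]
      · obtain ⟨t, rfl⟩ : ∃ t, k = l₁.length + (t + 1 + 1) :=
          ⟨k - l₁.length - 2, by omega⟩
        simp

lemma isAlt_toWord {q : ℕ} {c : SVRaw q} (hc : c ∈ SVCochain q) : IsAlt (toWord q c) := by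
  intro l₁ u v l₂
  by_cases h : (l₁ ++ v :: u :: l₂).length = q
  · obtain ⟨w, hw⟩ := exists_eq_ofFn h
    have hl : l₁.length + (l₂.length + 1 + 1) = q := by simpa using h
    have e := ofFn_comp_swap hw.symm (i := ⟨l₁.length, by omega⟩) (j := ⟨l₁.length + 1, by omega⟩)
      rfl rfl
    rw [← e, hw, toWord_ofFn, toWord_ofFn, mem_SVCochain_iff.mp hc,
      Equiv.Perm.sign_swap (by simp)]
    simp
  · rw [toWord_of_length_ne c h, toWord_of_length_ne c (by simpa using h), neg_zero]

lemma mem_SVCochain_of_isAlt {q : ℕ} {c : SVRaw q} {F : WordFun} (hF : IsAlt F)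
    (h : ∀ w, modeCoeff c w = F (List.ofFn w)) : c ∈ SVCochain q := by
  rw [mem_SVCochain_iff]
  cases q with
  | zero =>
    intro σ w
    rw [Subsingleton.elim σ 1]
    simp
  | succ q =>
    intro σ
    have hσ : σ ∈ Submonoid.closure
        (Set.range fun i : Fin q => Equiv.swap i.castSucc i.succ) := by
      rw [Equiv.Perm.mclosure_swap_castSucc_succ]
      trivial
    induction hσ using Submonoid.closure_induction with
    | mem σ hs =>
      obtain ⟨i, rfl⟩ := hs
      intro w
      have hl : (i : ℕ) + 1 < (List.ofFn w).length := by simp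
      have e : List.ofFn w = (List.ofFn w).take i ++ (List.ofFn w)[(i : ℕ)] ::
          (List.ofFn w)[(i : ℕ) + 1] :: (List.ofFn w).drop (i + 1 + 1) := by
        rw [← List.drop_eq_getElem_cons, ← List.drop_eq_getElem_cons, List.take_append_drop]
      have e' := ofFn_comp_swap e (i := i.castSucc) (j := i.succ) (by simp; omega) (by simp; omega)
      rw [h, h, e', hF, ← e, Equiv.Perm.sign_swap (by simp [Fin.ext_iff])]
      simp
    | one => simp
    | mul σ τ _ _ hσ hτ =>
      intro w
      rw [Equiv.Perm.coe_mul, ← Function.comp_assoc, hτ, hσ, Equiv.Perm.sign_mul]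
      push_cast
      ring

lemma mem_SVCochain_iff_isAlt {q : ℕ} {c : SVRaw q} : c ∈ SVCochain q ↔ IsAlt (toWord q c) :=
  ⟨isAlt_toWord, fun h => mem_SVCochain_of_isAlt h fun w => (toWord_ofFn c w).symm⟩

lemma wordD_eq_zero_of_length_ne {F : WordFun} {q : ℕ} (hF : ∀ l, l.length ≠ q → F l = 0)
    {l : List Mode} (hl : l.length ≠ q + 1) : wordD F l = 0 := by
  cases l with
  | nil => rfl
  | cons u l =>
    refine wordD_eq_zero_of_length (q := l.length) (fun l' e => hF l' ?_) _ rfl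
    rw [e]
    simpa using hl

lemma toWord_SVdLin {q : ℕ} {c : SVRaw q} (hc : c ∈ SVCochain q) :
    toWord (q + 1) (SVdLin q c) = wordD (toWord q c) := by
  refine toWord_eq_of _ (fun w => ?_) fun l hl =>
    wordD_eq_zero_of_length_ne (fun l => toWord_of_length_ne c) hl
  cases q with
  | zero => simp [SVdLin, SVd, modeCoeff, ncoef_zero, wordD, lieAct]
  | succ q =>
    rw [(isAlt_toWord hc).wordD_ofFn, modeCoeff]
    simp only [SVdLin, LinearMap.coe_mk, AddHom.coe_mk, SVd, ncoef_sum]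
    refine Finset.sum_congr rfl fun i _ => Finset.sum_congr rfl fun j _ => ?_
    split_ifs with h
    · rw [modeCoeff_SVdTerm c w h, ← toWord_ofFn, List.ofFn_cons]
    · exact ncoef_zero _

lemma lieAct_L_zero_ofFn {q : ℕ} (F : WordFun) (w : Fin q → Mode) :
    lieAct (L, 0) F (List.ofFn w) =
      -∑ i, ((w i).2 : ℂ) * F (List.ofFn (Function.update w i ((w i).1, (w i).2 - 1))) := by
  induction q generalizing F with
  | zero => simp [lieAct]
  | succ q ih =>
    have e : ∀ v : Mode, modeCoef (L, 0) v = -v.2 ∧ modeBrk (L, 0) v = (v.1, v.2 - 1) := by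
      rintro ⟨g, n⟩
      cases g <;> simp [modeCoef, modeBrk, SVbrk]
    conv_rhs => rw [Fin.sum_univ_succ]
    rw [List.ofFn_succ, lieAct, ih, (e _).1, (e _).2, neg_add, neg_mul]
    congr 3
    · rw [List.ofFn_succ]
      simp
    · funext i
      rw [List.ofFn_succ, contr, Function.update_of_ne (Fin.succ_ne_zero i).symm]
      congr 4
      funext k
      simp [Function.update_apply]

lemma toWord_SVpartial {q : ℕ} (c : SVRaw q) :
    toWord q (SVpartial 0 q c) = -lieAct (L, 0) (toWord q c) := by
  refine toWord_eq_of _ (fun w => ?_) fun l hl => ?_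
  · rw [Pi.neg_apply, lieAct_L_zero_ofFn, neg_neg, modeCoeff]
    simp only [SVpartial, LinearMap.coe_mk, AddHom.coe_mk, map_zero, zero_add, Finset.sum_mul,
      ncoef_sum]
    refine Finset.sum_congr rfl fun i _ => ?_
    rw [mul_comm, ncoef_mul_X, toWord_ofFn, modeCoeff]
    congr 3
    · funext k
      rcases eq_or_ne k i with rfl | hk <;> simp [*]
    · funext k
      rcases eq_or_ne k i with rfl | hk <;> simp [*]
  · obtain ⟨n, hn⟩ : ∃ n, l.length = n := ⟨_, rfl⟩
    obtain ⟨w, rfl⟩ := exists_eq_ofFn hn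
    rw [Pi.neg_apply, lieAct_L_zero_ofFn, neg_neg]
    refine Finset.sum_eq_zero fun i _ => ?_
    rw [toWord_of_length_ne c (by simpa using hl), mul_zero]

/-- Contraction of a cochain with `L` at the value `0` of the variable. -/
noncomputable def contrL (q : ℕ) : SVRaw (q + 1) →ₗ[ℂ] SVRaw q where
  toFun c a := aeval (Fin.cons 0 X : Fin (q + 1) → MvPolynomial (Fin q) ℂ) (c (Fin.cons L a))
  map_add' c c' := by
    funext a
    simp
  map_smul' r c := by
    funext a
    simp

lemma toWord_contrL {q : ℕ} (c : SVRaw (q + 1)) :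
    toWord q (contrL q c) = contr (L, 0) (toWord (q + 1) c) := by
  refine toWord_eq_of _ (fun w => ?_) fun l hl => toWord_of_length_ne c (by simpa using hl)
  rw [contr, ← List.ofFn_cons, toWord_ofFn, modeCoeff, modeCoeff]
  simp only [contrL, LinearMap.coe_mk, AddHom.coe_mk]
  rw [ncoef_aeval_cons_zero]
  congr 2
  · funext k
    cases k using Fin.cases <;> rfl
  · funext k
    cases k using Fin.cases <;> rfl

lemma SVdLin_mem {q : ℕ} {c : SVRaw q} (hc : c ∈ SVCochain q) : SVdLin q c ∈ SVCochain (q + 1) := by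
  rw [mem_SVCochain_iff_isAlt, toWord_SVdLin hc]
  exact (isAlt_toWord hc).wordD

lemma SVdLin_SVdLin {q : ℕ} {c : SVRaw q} (hc : c ∈ SVCochain q) :
    SVdLin (q + 1) (SVdLin q c) = 0 := by
  apply toWord_injective
  rw [toWord_SVdLin (SVdLin_mem hc), toWord_SVdLin hc, wordD_wordD, map_zero]

lemma SVpartial_mem {q : ℕ} {c : SVRaw q} (hc : c ∈ SVCochain q) :
    SVpartial 0 q c ∈ SVCochain q := by
  rw [mem_SVCochain_iff_isAlt, toWord_SVpartial, ← neg_one_smul ℂ]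
  exact ((isAlt_toWord hc).lieAct _).smul _

lemma SVdLin_SVpartial {q : ℕ} {c : SVRaw q} (hc : c ∈ SVCochain q) :
    SVdLin q (SVpartial 0 q c) = SVpartial 0 (q + 1) (SVdLin q c) := by
  apply toWord_injective
  rw [toWord_SVdLin (SVpartial_mem hc), toWord_SVpartial, toWord_SVpartial, toWord_SVdLin hc,
    lieAct_wordD, wordD_neg]

lemma SVpartial_injective (q : ℕ) : Function.Injective (SVpartial 0 (q + 1)) := by
  intro c c' h
  funext a
  have h := congrFun h a
  refine mul_left_cancel₀ ?_ h
  intro e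
  have := congrArg (MvPolynomial.aeval (Pi.single 0 1 : Fin (q + 1) → ℂ)) e
  simp [Finset.sum_pi_single'] at this

lemma SVpartial_zero : SVpartial 0 0 = 0 := by
  refine LinearMap.ext fun c => funext fun a => ?_
  simp [SVpartial]

lemma contrL_mem {q : ℕ} {c : SVRaw (q + 1)} (hc : c ∈ SVCochain (q + 1)) :
    contrL q c ∈ SVCochain q := by
  rw [mem_SVCochain_iff_isAlt, toWord_contrL]
  exact (isAlt_toWord hc).contr _

lemma contrL_SVdLin {q : ℕ} {c : SVRaw (q + 1)} (hc : c ∈ SVCochain (q + 1)) :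
    contrL (q + 1) (SVdLin (q + 1) c) = SVpartial 0 (q + 1) c - SVdLin q (contrL q c) := by
  apply toWord_injective
  rw [toWord_contrL, toWord_SVdLin hc, contr_wordD, map_sub, toWord_SVpartial,
    toWord_SVdLin (contrL_mem hc), toWord_contrL]

lemma SVdLin_zero : SVdLin 0 = 0 := rfl

lemma exists_mem_SVCochain {F : WordFun} (hF : IsAlt F) (hb : Bdd F) (q : ℕ) :
    ∃ c ∈ SVCochain q, (∀ l, l.length = q → toWord q c l = F l) ∧
      ∀ l, l.length = q + 1 → toWord (q + 1) (SVdLin q c) l = wordD F l := by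
  obtain ⟨c, hc⟩ := hb.exists_modeCoeff q
  have h : ∀ l : List Mode, l.length = q → toWord q c l = F l := fun l hl => by
    obtain ⟨w, rfl⟩ := exists_eq_ofFn hl
    rw [toWord_ofFn, hc]
  refine ⟨c, mem_SVCochain_of_isAlt hF hc, h, fun l hl => ?_⟩
  rw [toWord_SVdLin (mem_SVCochain_of_isAlt hF hc), ← sub_eq_zero, ← Pi.sub_apply, ← wordD_sub]
  exact wordD_eq_zero_of_length (fun l hl => sub_eq_zero.mpr (h l hl)) l hl

lemma evalTerms_add (F G : WordFun) (s : List (ℤ × List Mode)) :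
    evalTerms (F + G) s = evalTerms F s + evalTerms G s := by
  induction s with
  | nil => simp [evalTerms_nil]
  | cons p s ih => simp only [evalTerms_cons, ih, Pi.add_apply]; ring

lemma evalTerms_smul (r : ℂ) (F : WordFun) (s : List (ℤ × List Mode)) :
    evalTerms (r • F) s = r * evalTerms F s := by
  induction s with
  | nil => simp [evalTerms_nil]
  | cons p s ih => simp only [evalTerms_cons, ih, Pi.smul_apply, smul_eq_mul]; ring

/-- The test functionals on `q`-cochains. -/
noncomputable def testLin (q : ℕ) : SVRaw q →ₗ[ℂ] ({i : Fin 6 // repLen i = q} → ℂ) where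
  toFun c i := evalTerms (toWord q c) (testTerms i)
  map_add' c c' := by
    funext i
    simp [evalTerms_add]
  map_smul' r c := by
    funext i
    simp [evalTerms_smul]

lemma evalTerms_testTerms_of_ne {q : ℕ} (c : SVRaw q) {i : Fin 6} (hi : repLen i ≠ q) :
    evalTerms (toWord q c) (testTerms i) = 0 := by
  rw [evalTerms_congr (G := (0 : ℂ) • toWord q c), evalTerms_smul, zero_mul]
  intro p hp
  rw [toWord_of_length_ne c (by rwa [length_of_mem_testTerms i p hp])]
  simp

lemma mem_SVcoboundaries {q : ℕ} {c : SVRaw q} (hc : c ∈ SVcocycles q) (ht : testLin q c = 0) :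
    c ∈ SVcoboundaries q := by
  obtain ⟨G, hG, hb, hd⟩ := (isAlt_toWord hc.1).exists_wordD_eq (bdd_toWord c)
    (by rw [← toWord_SVdLin hc.1, LinearMap.mem_ker.mp hc.2, map_zero]) fun i => by
      by_cases hi : repLen i = q
      · exact congrFun ht ⟨i, hi⟩
      · exact evalTerms_testTerms_of_ne c hi
  cases q with
  | zero =>
    refine (Submodule.mem_bot ℂ).mpr (toWord_injective 0 ?_)
    rw [map_zero]
    funext l
    rcases l with _ | ⟨u, l⟩
    · rw [← hd]
      rfl
    · exact toWord_of_length_ne c (by simp)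
  | succ q =>
    obtain ⟨c', hc', -, h⟩ := exists_mem_SVCochain hG hb q
    refine ⟨c', hc', toWord_injective _ ?_⟩
    funext l
    by_cases hl : l.length = q + 1
    · rw [h l hl, hd]
    · rw [toWord_of_length_ne _ hl, toWord_of_length_ne _ hl]

lemma testLin_eq_zero {q : ℕ} {c : SVRaw q} (hc : c ∈ SVcoboundaries q) : testLin q c = 0 := by
  cases q with
  | zero => rw [(Submodule.mem_bot ℂ).mp hc, map_zero]
  | succ q =>
    obtain ⟨c', hc', rfl⟩ := hc
    funext i
    change evalTerms (toWord (q + 1) (SVdLin q c')) (testTerms i) = 0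
    rw [toWord_SVdLin hc']
    exact (isAlt_toWord hc').evalTerms_wordD _

lemma exists_testLin_eq {q : ℕ} (x : {i : Fin 6 // repLen i = q} → ℂ) :
    ∃ c ∈ SVcocycles q, testLin q c = x := by
  suffices h : (SVcocycles q).map (testLin q) = ⊤ by
    have : x ∈ (SVcocycles q).map (testLin q) := h ▸ Submodule.mem_top
    exact this
  rw [eq_top_iff, ← (Pi.basisFun ℂ {i : Fin 6 // repLen i = q}).span_eq, Submodule.span_le]
  rintro _ ⟨i, rfl⟩
  obtain ⟨c, hc, h, h'⟩ := exists_mem_SVCochain (isAlt_repFun i)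
    ((isAlt_repFun i).bdd (isInvariant_repFun i)) q
  refine ⟨c, ⟨hc, toWord_injective _ ?_⟩, ?_⟩
  · funext l
    rw [map_zero]
    by_cases hl : l.length = q + 1
    · rw [h' l hl, wordD_repFun]
    · exact toWord_of_length_ne _ hl
  · funext j
    change evalTerms (toWord q c) (testTerms j) = _
    rw [evalTerms_congr (G := repFun i), evalTerms_repFun]
    · simp [Pi.single_apply, Subtype.ext_iff]
    · exact fun p hp => h _ ((length_of_mem_testTerms j p hp).trans j.2)

/-- Every representative of a reduced cocycle is a cocycle plus a contracted cocycle. -/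
lemma exists_eq_add_contrL {q : ℕ} {c : SVRaw q} (hc : c ∈ SVredCocycles 0 q) :
    ∃ z ∈ SVcocycles q, ∃ φ ∈ SVcocycles (q + 1), c = z + contrL q φ := by
  obtain ⟨hc, φ, hφ, e⟩ := hc
  have hd : SVdLin (q + 1) φ = 0 := by
    apply SVpartial_injective
    rw [← SVdLin_SVpartial hφ, e, SVdLin_SVdLin hc, map_zero]
  refine ⟨c - contrL q φ, ⟨sub_mem hc (contrL_mem hφ), ?_⟩, φ, ⟨hφ, hd⟩, by simp⟩
  have := contrL_SVdLin hφ
  rw [hd, map_zero, e, eq_comm] at this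
  exact LinearMap.mem_ker.mpr (by rw [map_sub, this])

lemma add_contrL_mem {q : ℕ} {z : SVRaw q} {φ : SVRaw (q + 1)} (hz : z ∈ SVcocycles q)
    (hφ : φ ∈ SVcocycles (q + 1)) : z + contrL q φ ∈ SVredCocycles 0 q := by
  refine ⟨add_mem hz.1 (contrL_mem hφ.1), φ, hφ.1, ?_⟩
  have := contrL_SVdLin hφ.1
  rw [LinearMap.mem_ker.mp hφ.2, map_zero, eq_comm, sub_eq_zero] at this
  rw [map_add, LinearMap.mem_ker.mp hz.2, zero_add, this]

lemma SVpartialSub_zero : SVpartialSub 0 0 = ⊥ := by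
  rw [SVpartialSub, SVpartial_zero, Submodule.map_zero]

lemma add_contrL_mem_SVredCoboundaries {q : ℕ} {z : SVRaw q} {φ : SVRaw (q + 1)}
    (hz : z ∈ SVcocycles q) (hφ : φ ∈ SVcocycles (q + 1)) :
    z + contrL q φ ∈ SVredCoboundaries 0 q ↔
      z ∈ SVcoboundaries q ∧ φ ∈ SVcoboundaries (q + 1) := by
  have key := contrL_SVdLin hφ.1
  rw [LinearMap.mem_ker.mp hφ.2, map_zero, eq_comm, sub_eq_zero] at key
  cases q with
  | zero =>
    rw [SVredCoboundaries, SVpartialSub_zero, SVcoboundaries, Submodule.mem_bot, Submodule.mem_bot,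
      SVcoboundaries, SVdLin_zero, Submodule.map_zero, Submodule.mem_bot]
    constructor
    · intro e
      have h : φ = 0 := by
        apply SVpartial_injective
        rw [key, SVdLin_zero, LinearMap.zero_apply, map_zero]
      subst h
      simpa using e
    · rintro ⟨rfl, rfl⟩
      simp
  | succ q =>
    constructor
    · intro h
      obtain ⟨_, ⟨α, hα, rfl⟩, _, ⟨β, hβ, rfl⟩, e⟩ := Submodule.mem_sup.mp h
      have h : φ = SVdLin (q + 1) α := by
        apply SVpartial_injective
        rw [key, ← SVdLin_SVpartial hα, eq_comm, ← sub_eq_zero, ← map_sub, eq_sub_of_add_eq e,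
          map_sub, map_sub, map_add, LinearMap.mem_ker.mp hz.2, SVdLin_SVdLin hβ]
        simp
      subst h
      refine ⟨⟨β + contrL q α, add_mem hβ (contrL_mem hα), ?_⟩, α, hα, rfl⟩
      rw [contrL_SVdLin hα] at e
      rw [map_add]
      linear_combination (exp := 1) e
    · rintro ⟨⟨β, hβ, rfl⟩, α, hα, rfl⟩
      refine Submodule.mem_sup.mpr ⟨_, ⟨α, hα, rfl⟩, _, ⟨β - contrL q α,
        sub_mem hβ (contrL_mem hα), rfl⟩, ?_⟩
      rw [contrL_SVdLin hα, map_sub]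
      abel

lemma mem_SVcoboundaries_iff {q : ℕ} {c : SVRaw q} (hc : c ∈ SVcocycles q) :
    c ∈ SVcoboundaries q ↔ testLin q c = 0 :=
  ⟨testLin_eq_zero, mem_SVcoboundaries hc⟩

/-- Pairs of cocycles in degrees `q` and `q + 1` represent reduced cocycles in degree `q`. -/
noncomputable def pairToRed (q : ℕ) : SVcocycles q × SVcocycles (q + 1) →ₗ[ℂ] SVredCocycles 0 q :=
  LinearMap.codRestrict _
    ((SVcocycles q).subtype.coprod (contrL q ∘ₗ (SVcocycles (q + 1)).subtype))
    fun p => add_contrL_mem p.1.2 p.2.2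

lemma finrank_SVredH (q : ℕ) :
    Module.finrank ℂ (SVredH 0 q) =
      Fintype.card {i : Fin 6 // repLen i = q} + Fintype.card {i : Fin 6 // repLen i = q + 1} := by
  let B := (SVredCoboundaries 0 q).comap (SVredCocycles 0 q).subtype
  let P : SVcocycles q × SVcocycles (q + 1) →ₗ[ℂ] SVredCocycles 0 q ⧸ B :=
    B.mkQ ∘ₗ pairToRed q
  let T : SVcocycles q × SVcocycles (q + 1) →ₗ[ℂ]
      ({i : Fin 6 // repLen i = q} → ℂ) × ({i : Fin 6 // repLen i = q + 1} → ℂ) :=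
    (testLin q ∘ₗ (SVcocycles q).subtype).prodMap
      (testLin (q + 1) ∘ₗ (SVcocycles (q + 1)).subtype)
  have hP : Function.Surjective P := by
    intro x
    obtain ⟨⟨c, hc⟩, rfl⟩ := B.mkQ_surjective x
    obtain ⟨z, hz, φ, hφ, rfl⟩ := exists_eq_add_contrL hc
    exact ⟨(⟨z, hz⟩, ⟨φ, hφ⟩), rfl⟩
  have hT : Function.Surjective T := by
    rintro ⟨x, y⟩
    obtain ⟨z, hz, rfl⟩ := exists_testLin_eq x
    obtain ⟨φ, hφ, rfl⟩ := exists_testLin_eq y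
    exact ⟨(⟨z, hz⟩, ⟨φ, hφ⟩), rfl⟩
  have hk : LinearMap.ker P = LinearMap.ker T := by
    ext ⟨z, φ⟩
    have h1 : P (z, φ) = 0 ↔ (z : SVRaw q) + contrL q φ ∈ SVredCoboundaries 0 q :=
      Submodule.Quotient.mk_eq_zero B
    have h2 : T (z, φ) = 0 ↔ testLin q z = 0 ∧ testLin (q + 1) φ = 0 := Prod.mk_eq_zero
    rw [LinearMap.mem_ker, LinearMap.mem_ker, h1, h2, add_contrL_mem_SVredCoboundaries z.2 φ.2,
      mem_SVcoboundaries_iff z.2, mem_SVcoboundaries_iff φ.2]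
  change Module.finrank ℂ (SVredCocycles 0 q ⧸ B) = _
  rw [← (P.quotKerEquivOfSurjective hP).finrank_eq, hk,
    (T.quotKerEquivOfSurjective hT).finrank_eq, Module.finrank_prod,
    Module.finrank_fintype_fun_eq_card,
    Module.finrank_fintype_fun_eq_card]

lemma SVcocycles_le_of_isEmpty {q : ℕ} (h : ∀ i, repLen i ≠ q) : SVcocycles q ≤ SVcoboundaries q :=
  fun _ hc => mem_SVcoboundaries hc (funext fun i => absurd i.2 (h i))

lemma SVredCocycles_le {q : ℕ} (h : ∀ i, repLen i ≠ q) (h' : ∀ i, repLen i ≠ q + 1) :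
    SVredCocycles 0 q ≤ SVredCoboundaries 0 q := by
  intro c hc
  obtain ⟨z, hz, φ, hφ, rfl⟩ := exists_eq_add_contrL hc
  exact (add_contrL_mem_SVredCoboundaries hz hφ).mpr
    ⟨SVcocycles_le_of_isEmpty h hz, SVcocycles_le_of_isEmpty h' hφ⟩

lemma repLen_le (i : Fin 6) : repLen i ≤ 6 := by
  fin_cases i <;> simp [repLen]

/-- The reduced cohomology of `SV` with trivial coefficients:
`dim H^q(SV,ℂ) = 1` for `q = 0, 2, 3`, `= 2` for `q = 4, 6`, `= 4` for `q = 5`,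
and `H^q(SV,ℂ) = 0` otherwise (namely for `q = 1` and `q ≥ 7`). -/
theorem statement14 :
    (∀ q : ℕ, Module.finrank ℂ (SVredH 0 q) =
      if q = 0 ∨ q = 2 ∨ q = 3 then 1
      else if q = 4 ∨ q = 6 then 2
      else if q = 5 then 4 else 0) ∧
    (∀ q : ℕ, q = 1 ∨ 7 ≤ q → SVredCocycles 0 q ≤ SVredCoboundaries 0 q) := by
  refine ⟨fun q => ?_, fun q hq => ?_⟩
  · rw [finrank_SVredH]
    rcases lt_or_ge q 7 with h | h
    · interval_cases q <;> decide
    · have e : ∀ p, 7 ≤ p → Fintype.card {i : Fin 6 // repLen i = p} = 0 := fun p hp =>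
        Fintype.card_eq_zero_iff.mpr ⟨fun i => by have := repLen_le i; have := i.2; omega⟩
      rw [e q h, e (q + 1) (by omega), if_neg (by omega), if_neg (by omega), if_neg (by omega)]
  · rcases hq with rfl | h
    · exact SVredCocycles_le (by decide) (by decide)
    · exact SVredCocycles_le (fun i => by have := repLen_le i; omega)
        fun i => by have := repLen_le i; omega

end SVCA
end

section
/- For all α, β ∈ ℂ with β ≠ 0 and every q ∈ ℤ≥0, the reduced cohomology of the Schrödinger-Virasoro conformal algebra with coefficients in the rank-one module M_{α,β} vanishes: H^q(SV,M_{α,β}) = 0. -/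
/-!
Cochain complex of the Schrödinger–Virasoro conformal algebra
`SV = ℂ[∂]L ⊕ ℂ[∂]Y ⊕ ℂ[∂]M` with coefficients in the free rank-one module
`M_{α,β} = ℂ[∂]v`, where `L_λ v = (∂+αλ+β)v` and `Y_λ v = M_λ v = 0`.

A `q`-cochain is a `ℂ`-linear, conformally antilinear, skew-symmetric map
`SV^{⊗q} → M_{α,β}[λ₁,…,λ_q]`; it is determined by its values on `q`-tuples of
generators, so we model cochains as functions from generator tuples to
`M_{α,β}[λ₁,…,λ_q] = ℂ[∂][λ₁,…,λ_q]`, realized as polynomials in `∂`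
(`Polynomial`) with coefficients in `ℂ[λ₁,…,λ_q]` (`MvPolynomial`).
-/

namespace SVCA

open SVGen

noncomputable instance (q : ℕ) : AddCommGroup (Polynomial (MvPolynomial (Fin q) ℂ)) :=
  inferInstance
noncomputable instance (q : ℕ) : Module ℂ (Polynomial (MvPolynomial (Fin q) ℂ)) :=
  inferInstance

/-- Raw `q`-cochains with coefficients in `M_{α,β}`: functions from `q`-tuples
of generators to `ℂ[∂][λ₁,…,λ_q]` (outer variable `∂`). -/
abbrev MRaw (q : ℕ) := (Fin q → SVGen) → Polynomial (MvPolynomial (Fin q) ℂ)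

/-- The subspace of skew-symmetric cochains `C̃^q(SV, M_{α,β})`. -/
noncomputable def MCochain (q : ℕ) : Submodule ℂ (MRaw q) where
  carrier := {c | ∀ (σ : Equiv.Perm (Fin q)) (a : Fin q → SVGen),
      Polynomial.mapAlgHom (MvPolynomial.rename (σ : Fin q → Fin q)) (c (a ∘ σ)) =
        ((Equiv.Perm.sign σ : ℤ) : ℂ) • c a}
  add_mem' := by
    intro c c' hc hc' σ a
    simp only [Pi.add_apply, map_add, hc σ a, hc' σ a, smul_add]
  zero_mem' := by intro σ a; simp
  smul_mem' := by
    intro r c hc σ a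
    simp only [Pi.smul_apply, map_smul, hc σ a]
    rw [smul_comm]

/-- The `i`-th module-action summand of the differential:
`(-1)^{i+1} a_{i λᵢ} γ_{λ₁,…,λ̂ᵢ,…}(a₁,…,âᵢ,…)`.  Only `L` acts (by
`L_{λᵢ}(w(∂)v) = w(∂+λᵢ)(∂+αλᵢ+β)v`); `Y` and `M` act by zero. -/
noncomputable def MActTerm (α β : ℂ) {q : ℕ} (c : MRaw q) (a : Fin (q + 1) → SVGen)
    (i : Fin (q + 1)) : Polynomial (MvPolynomial (Fin (q + 1)) ℂ) :=
  if a i = SVGen.L then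
    ((-1 : ℂ) ^ (i : ℕ)) •
      ((Polynomial.X + Polynomial.C (MvPolynomial.C α * MvPolynomial.X i + MvPolynomial.C β)) *
        Polynomial.eval₂ Polynomial.C (Polynomial.X + Polynomial.C (MvPolynomial.X i))
          (Polynomial.mapAlgHom (MvPolynomial.rename i.succAbove) (c (a ∘ i.succAbove))))
  else 0

/-- The `(i,j)`-bracket summand of the differential:
`(-1)^{i+j} γ_{λᵢ+λⱼ, λ₁, …, λ̂ᵢ, …, λ̂ⱼ, …}([a_{i λᵢ} a_j], a₁, …, âᵢ, …, âⱼ, …)`,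
where `[a_{i λᵢ} a_j] = (c₁∂ + c₂λᵢ)x` and conformal antilinearity in the first
slot (whose variable is `λᵢ+λⱼ`) produces the factor `c₂λᵢ - c₁(λᵢ+λⱼ)`. -/
noncomputable def MdTerm {q : ℕ} (c : MRaw (q + 1)) (a : Fin (q + 2) → SVGen)
    (i j : Fin (q + 2)) : Polynomial (MvPolynomial (Fin (q + 2)) ℂ) :=
  ((-1 : ℂ) ^ ((i : ℕ) + (j : ℕ))) •
    (Polynomial.C (MvPolynomial.C (SVbrk (a i) (a j)).2.2 * MvPolynomial.X i
        - MvPolynomial.C (SVbrk (a i) (a j)).2.1 * (MvPolynomial.X i + MvPolynomial.X j)) *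
      Polynomial.mapAlgHom
        (MvPolynomial.aeval (Fin.cons (MvPolynomial.X i + MvPolynomial.X j)
          fun k => MvPolynomial.X (SVskip i j k)))
        (c (Fin.cons (SVbrk (a i) (a j)).1 fun k => a (SVskip i j k))))

/-- The differential `d_q : C̃^q(SV,M_{α,β}) → C̃^{q+1}(SV,M_{α,β})`. -/
noncomputable def Md (α β : ℂ) : {q : ℕ} → MRaw q → MRaw (q + 1)
  | 0, c => fun a => ∑ i : Fin 1, MActTerm α β c a i
  | (q + 1), c => fun a =>
      (∑ i : Fin (q + 2), MActTerm α β c a i) +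
        ∑ i : Fin (q + 2), ∑ j : Fin (q + 2),
          if (i : ℕ) < (j : ℕ) then MdTerm c a i j else 0

lemma MActTerm_add (α β : ℂ) {q : ℕ} (c c' : MRaw q) (a : Fin (q + 1) → SVGen)
    (i : Fin (q + 1)) :
    MActTerm α β (c + c') a i = MActTerm α β c a i + MActTerm α β c' a i := by
  by_cases h : a i = SVGen.L <;>
    simp [MActTerm, h, mul_add, smul_add, Polynomial.eval₂_add]

lemma MActTerm_smul (α β : ℂ) {q : ℕ} (r : ℂ) (c : MRaw q) (a : Fin (q + 1) → SVGen)
    (i : Fin (q + 1)) :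
    MActTerm α β (r • c) a i = r • MActTerm α β c a i := by
  have key : ∀ (p x : Polynomial (MvPolynomial (Fin (q + 1)) ℂ)),
      Polynomial.eval₂ Polynomial.C x (r • p) = r • Polynomial.eval₂ Polynomial.C x p := by
    intro p x
    rw [Algebra.smul_def, Algebra.smul_def, Polynomial.eval₂_mul, Polynomial.algebraMap_apply,
      Polynomial.eval₂_C]
  by_cases h : a i = SVGen.L
  · simp only [MActTerm, h, if_true, Pi.smul_apply, map_smul, key, mul_smul_comm]
    rw [smul_comm]
  · simp [MActTerm, h]

lemma MdTerm_add {q : ℕ} (c c' : MRaw (q + 1)) (a : Fin (q + 2) → SVGen)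
    (i j : Fin (q + 2)) :
    MdTerm (c + c') a i j = MdTerm c a i j + MdTerm c' a i j := by
  simp [MdTerm, mul_add, smul_add]

lemma MdTerm_smul {q : ℕ} (r : ℂ) (c : MRaw (q + 1)) (a : Fin (q + 2) → SVGen)
    (i j : Fin (q + 2)) :
    MdTerm (r • c) a i j = r • MdTerm c a i j := by
  simp only [MdTerm, Pi.smul_apply, map_smul, mul_smul_comm]
  rw [smul_comm]

/-- The differential as a `ℂ`-linear map. -/
noncomputable def MdLin (α β : ℂ) (q : ℕ) : MRaw q →ₗ[ℂ] MRaw (q + 1) where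
  toFun := Md α β
  map_add' c c' := by
    have h1 : ∀ (n : ℕ) (d d' : MRaw n) (a : Fin (n + 1) → SVGen),
        (∑ i : Fin (n + 1), MActTerm α β (d + d') a i) =
          (∑ i : Fin (n + 1), MActTerm α β d a i) +
            ∑ i : Fin (n + 1), MActTerm α β d' a i := by
      intro n d d' a
      rw [← Finset.sum_add_distrib]
      exact Finset.sum_congr rfl fun i _ => MActTerm_add α β d d' a i
    cases q with
    | zero => funext a; exact h1 0 c c' a
    | succ q =>
      funext a
      simp only [Md, Pi.add_apply]
      rw [h1 (q + 1) c c' a]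
      have h2 : (∑ i : Fin (q + 2), ∑ j : Fin (q + 2),
            if (i : ℕ) < (j : ℕ) then MdTerm (c + c') a i j else 0) =
          (∑ i : Fin (q + 2), ∑ j : Fin (q + 2),
            if (i : ℕ) < (j : ℕ) then MdTerm c a i j else 0) +
            ∑ i : Fin (q + 2), ∑ j : Fin (q + 2),
              if (i : ℕ) < (j : ℕ) then MdTerm c' a i j else 0 := by
        rw [← Finset.sum_add_distrib]
        refine Finset.sum_congr rfl fun i _ => ?_
        rw [← Finset.sum_add_distrib]
        refine Finset.sum_congr rfl fun j _ => ?_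
        by_cases h : (i : ℕ) < (j : ℕ)
        · simp [h, MdTerm_add]
        · simp [h]
      rw [h2]
      abel
  map_smul' r c := by
    have h1 : ∀ (n : ℕ) (d : MRaw n) (a : Fin (n + 1) → SVGen),
        (∑ i : Fin (n + 1), MActTerm α β (r • d) a i) =
          r • ∑ i : Fin (n + 1), MActTerm α β d a i := by
      intro n d a
      rw [Finset.smul_sum]
      exact Finset.sum_congr rfl fun i _ => MActTerm_smul α β r d a i
    cases q with
    | zero => funext a; exact h1 0 c a
    | succ q =>
      funext a
      simp only [Md, RingHom.id_apply, Pi.smul_apply]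
      rw [h1 (q + 1) c a, smul_add]
      congr 1
      rw [Finset.smul_sum]
      refine Finset.sum_congr rfl fun i _ => ?_
      rw [Finset.smul_sum]
      refine Finset.sum_congr rfl fun j _ => ?_
      by_cases h : (i : ℕ) < (j : ℕ)
      · simp [h, MdTerm_smul]
      · simp [h]

/-- The action of `∂` on `q`-cochains with coefficients in `M_{α,β}`:
`(∂γ)_{λ₁,…,λ_q} = (∂_V + λ₁ + ⋯ + λ_q)·γ_{λ₁,…,λ_q}`. -/
noncomputable def Mpartial (q : ℕ) : MRaw q →ₗ[ℂ] MRaw q where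
  toFun c := fun t =>
    (Polynomial.X + Polynomial.C (∑ i, MvPolynomial.X i)) * c t
  map_add' c c' := by funext t; simp [mul_add]
  map_smul' r c := by funext t; simp [mul_smul_comm]

/-- The subspace `∂C̃^q(SV,M_{α,β})`. -/
noncomputable def MpartialSub (q : ℕ) : Submodule ℂ (MRaw q) :=
  Submodule.map (Mpartial q) (MCochain q)

/-- Representatives of reduced `q`-cocycles: cochains `γ` with `dγ ∈ ∂C̃^{q+1}`. -/
noncomputable def MredCocycles (α β : ℂ) (q : ℕ) : Submodule ℂ (MRaw q) :=
  MCochain q ⊓ Submodule.comap (MdLin α β q) (MpartialSub (q + 1))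

/-- Representatives of reduced `q`-coboundaries: `∂C̃^q + dC̃^{q-1}`. -/
noncomputable def MredCoboundaries (α β : ℂ) : (q : ℕ) → Submodule ℂ (MRaw q)
  | 0 => MpartialSub 0
  | (q + 1) => MpartialSub (q + 1) ⊔ Submodule.map (MdLin α β q) (MCochain q)

/-- The reduced cohomology `H^q(SV,M_{α,β})`, realized (via the third
isomorphism theorem) as `{γ ∈ C̃^q : dγ ∈ ∂C̃^{q+1}} / (∂C̃^q + dC̃^{q-1})`. -/
noncomputable def MredH (α β : ℂ) (q : ℕ) :=
  MredCocycles α β q ⧸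
    Submodule.comap (MredCocycles α β q).subtype (MredCoboundaries α β q)

noncomputable instance (α β : ℂ) (q : ℕ) : AddCommGroup (MredH α β q) := by
  unfold MredH; infer_instance
noncomputable instance (α β : ℂ) (q : ℕ) : Module ℂ (MredH α β q) := by
  unfold MredH; infer_instance

/-- Substitution of polynomials `f k` for the variables `λ_k`, coefficientwise in `∂`. -/
noncomputable def lamSubst {m n : ℕ} (f : Fin m → MvPolynomial (Fin n) ℂ) :
    Polynomial (MvPolynomial (Fin m) ℂ) →ₐ[ℂ] Polynomial (MvPolynomial (Fin n) ℂ) :=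
  Polynomial.mapAlgHom (MvPolynomial.aeval f)

lemma mapAlgHom_rename_eq_lamSubst {m n : ℕ} (σ : Fin m → Fin n)
    (p : Polynomial (MvPolynomial (Fin m) ℂ)) :
    Polynomial.mapAlgHom (MvPolynomial.rename σ) p =
      lamSubst (fun k => MvPolynomial.X (σ k)) p := by
  have h : (MvPolynomial.rename σ : MvPolynomial (Fin m) ℂ →ₐ[ℂ] MvPolynomial (Fin n) ℂ) =
      MvPolynomial.aeval (fun k => MvPolynomial.X (σ k)) := by
    ext k; simp
  rw [h, lamSubst]

lemma lamSubst_X {m n : ℕ} (f : Fin m → MvPolynomial (Fin n) ℂ) :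
    lamSubst f Polynomial.X = Polynomial.X := by
  simp [lamSubst]

lemma lamSubst_C {m n : ℕ} (f : Fin m → MvPolynomial (Fin n) ℂ) (r : MvPolynomial (Fin m) ℂ) :
    lamSubst f (Polynomial.C r) = Polynomial.C (MvPolynomial.aeval f r) := by
  simp [lamSubst]

lemma lamSubst_lamSubst {l m n : ℕ} (f : Fin l → MvPolynomial (Fin m) ℂ)
    (g : Fin m → MvPolynomial (Fin n) ℂ) (p : Polynomial (MvPolynomial (Fin l) ℂ)) :
    lamSubst g (lamSubst f p) = lamSubst (fun k => MvPolynomial.aeval g (f k)) p := by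
  have h : (MvPolynomial.aeval g).comp (MvPolynomial.aeval f) =
      MvPolynomial.aeval (fun k => MvPolynomial.aeval g (f k)) := by
    ext k; simp
  simp only [lamSubst, ← h]
  rw [← Polynomial.mapAlgHom_comp, AlgHom.comp_apply]

lemma lamSubst_self {n : ℕ} (p : Polynomial (MvPolynomial (Fin n) ℂ)) :
    lamSubst MvPolynomial.X p = p := by
  simp [lamSubst]

/-- Substitution of the `λ`'s commutes with translation of `∂`. -/
lemma lamSubst_eval₂ {m n : ℕ} (f : Fin m → MvPolynomial (Fin n) ℂ)
    (r : MvPolynomial (Fin m) ℂ) (p : Polynomial (MvPolynomial (Fin m) ℂ)) :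
    lamSubst f (Polynomial.eval₂ Polynomial.C (Polynomial.X + Polynomial.C r) p) =
      Polynomial.eval₂ Polynomial.C (Polynomial.X + Polynomial.C (MvPolynomial.aeval f r))
        (lamSubst f p) := by
  induction p using Polynomial.induction_on' with
  | add p q hp hq => simp only [Polynomial.eval₂_add, map_add, hp, hq]
  | monomial k s =>
    rw [← Polynomial.C_mul_X_pow_eq_monomial]
    simp [Polynomial.eval₂_mul, Polynomial.eval₂_pow, lamSubst_X, lamSubst_C]

lemma lamSubst_perm {q n : ℕ} {c : MRaw q} (hc : c ∈ MCochain q) (σ : Equiv.Perm (Fin q))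
    (a : Fin q → SVGen) (f : Fin q → MvPolynomial (Fin n) ℂ) :
    lamSubst (f ∘ σ) (c (a ∘ σ)) = ((Equiv.Perm.sign σ : ℤ) : ℂ) • lamSubst f (c a) := by
  rw [← map_smul, ← hc σ a, mapAlgHom_rename_eq_lamSubst, lamSubst_lamSubst]
  simp [Function.comp_def]

/-- Contraction with `L` at `λ = 0` in the first slot. -/
noncomputable def contractL (q : ℕ) (c : MRaw (q + 1)) : MRaw q := fun a =>
  lamSubst (Fin.cons 0 MvPolynomial.X) (c (Fin.cons L a))

lemma contractL_mem {q : ℕ} {c : MRaw (q + 1)} (hc : c ∈ MCochain (q + 1)) :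
    contractL q c ∈ MCochain q := by
  intro σ a
  set τ : Equiv.Perm (Fin (q + 1)) := Equiv.Perm.decomposeFin.symm (0, σ) with hτ
  have ha : (Fin.cons L (a ∘ σ) : Fin (q + 1) → SVGen) = (Fin.cons L a) ∘ τ := by
    funext k
    refine Fin.cases ?_ (fun k => ?_) k <;> simp [hτ]
  have hs : Equiv.Perm.sign τ = Equiv.Perm.sign σ := by
    simp [hτ]
  rw [mapAlgHom_rename_eq_lamSubst, contractL, contractL, lamSubst_lamSubst, ha, ← hs,
    ← lamSubst_perm hc τ]
  congr 2
  funext k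
  refine Fin.cases ?_ (fun k => ?_) k <;> simp [hτ]

lemma contractL_partial {q : ℕ} (c : MRaw (q + 1)) :
    contractL q (Mpartial (q + 1) c) = Mpartial q (contractL q c) := by
  funext a
  have hsum : MvPolynomial.aeval (Fin.cons 0 MvPolynomial.X :
      Fin (q + 1) → MvPolynomial (Fin q) ℂ)
        (∑ i, MvPolynomial.X i : MvPolynomial (Fin (q + 1)) ℂ) = ∑ i, MvPolynomial.X i := by
    rw [Fin.sum_univ_succ]
    simp
  simp only [contractL, Mpartial, LinearMap.coe_mk, AddHom.coe_mk]
  rw [map_mul, map_add, lamSubst_X, lamSubst_C, hsum]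

lemma contractL_MActTerm_zero (α β : ℂ) {q : ℕ} (c : MRaw q) (a : Fin q → SVGen) :
    lamSubst (Fin.cons 0 MvPolynomial.X) (MActTerm α β c (Fin.cons L a) 0) =
      (Polynomial.X + Polynomial.C (MvPolynomial.C β)) * c a := by
  have ha : (Fin.cons L a : Fin (q + 1) → SVGen) ∘ Fin.succ = a := by
    funext k; simp
  simp [MActTerm, lamSubst_X, lamSubst_C, lamSubst_eval₂, mapAlgHom_rename_eq_lamSubst,
    lamSubst_lamSubst, lamSubst_self, ha, MvPolynomial.algebraMap_eq]

lemma contractL_MActTerm_succ (α β : ℂ) {q : ℕ} (c : MRaw (q + 1)) (a : Fin (q + 1) → SVGen)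
    (i : Fin (q + 1)) :
    lamSubst (Fin.cons 0 MvPolynomial.X) (MActTerm α β c (Fin.cons L a) i.succ) =
      (-1 : ℂ) • MActTerm α β (contractL q c) a i := by
  have ha : (Fin.cons L a : Fin (q + 2) → SVGen) ∘ i.succ.succAbove =
      Fin.cons L (a ∘ i.succAbove) := by
    funext k
    refine Fin.cases ?_ (fun k => ?_) k <;> simp
  have hf : (fun k => MvPolynomial.aeval (Fin.cons 0 MvPolynomial.X :
        Fin (q + 2) → MvPolynomial (Fin (q + 1)) ℂ)
        (MvPolynomial.X (i.succ.succAbove k) : MvPolynomial (Fin (q + 2)) ℂ)) =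
      fun k => MvPolynomial.aeval (fun k => MvPolynomial.X (i.succAbove k))
        ((Fin.cons 0 MvPolynomial.X : Fin (q + 1) → MvPolynomial (Fin q) ℂ) k) := by
    funext k
    refine Fin.cases ?_ (fun k => ?_) k <;> simp
  by_cases h : a i = L
  · have hlin : MvPolynomial.aeval (Fin.cons 0 MvPolynomial.X :
        Fin (q + 2) → MvPolynomial (Fin (q + 1)) ℂ)
        (MvPolynomial.C α * MvPolynomial.X i.succ + MvPolynomial.C β) =
          MvPolynomial.C α * MvPolynomial.X i + MvPolynomial.C β := by
      simp [MvPolynomial.algebraMap_eq]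
    rw [MActTerm, MActTerm, Fin.cons_succ, if_pos h, if_pos h, map_smul, map_mul, map_add,
      lamSubst_X, lamSubst_C, lamSubst_eval₂, mapAlgHom_rename_eq_lamSubst,
      mapAlgHom_rename_eq_lamSubst, lamSubst_lamSubst, ha, hf, contractL, lamSubst_lamSubst, hlin,
      MvPolynomial.aeval_X, Fin.cons_succ, Fin.val_succ, pow_succ', mul_smul]
  · simp [MActTerm, h]

lemma contractL_MdTerm_zero {n : ℕ} {c : MRaw (n + 1)} (hc : c ∈ MCochain (n + 1))
    (a : Fin (n + 1) → SVGen) (k : Fin (n + 1)) :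
    lamSubst (Fin.cons 0 MvPolynomial.X) (MdTerm c (Fin.cons L a) 0 k.succ) =
      Polynomial.C (MvPolynomial.X k) * c a := by
  have hbrk : ∀ x : SVGen, (SVbrk L x).1 = x ∧ (SVbrk L x).2.1 = 1 := by
    intro x; cases x <;> simp [SVbrk]
  have hskip : ∀ m : Fin n, SVskip 0 k.succ m = (k.succAbove m).succ := by
    intro m
    have h0 : (⟨min ((0 : Fin (n + 2)) : ℕ) n, Nat.lt_succ_of_le (Nat.min_le_right _ _)⟩ :
        Fin (n + 1)) = 0 := by ext; simp
    rw [SVskip, h0, Fin.succAbove_zero, Fin.succ_succAbove_succ]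
  have ha : (Fin.cons (a k) fun m => a (k.succAbove m) : Fin (n + 1) → SVGen) =
      a ∘ k.cycleRange.symm := by
    funext m
    refine Fin.cases ?_ (fun m => ?_) m <;> simp
  have hf : (fun m => MvPolynomial.aeval (Fin.cons 0 MvPolynomial.X :
        Fin (n + 2) → MvPolynomial (Fin (n + 1)) ℂ)
        ((Fin.cons (MvPolynomial.X 0 + MvPolynomial.X k.succ)
          fun m => MvPolynomial.X (k.succAbove m).succ :
            Fin (n + 1) → MvPolynomial (Fin (n + 2)) ℂ) m)) =
      MvPolynomial.X ∘ k.cycleRange.symm := by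
    funext m
    refine Fin.cases ?_ (fun m => ?_) m <;> simp
  have hsign : (((Equiv.Perm.sign k.cycleRange.symm : ℤˣ) : ℤ) : ℂ) = (-1) ^ (k : ℕ) := by
    simp [Equiv.Perm.sign_symm, Fin.sign_cycleRange]
  rw [MdTerm]
  simp only [Fin.cons_zero, Fin.cons_succ, hskip, hbrk]
  rw [← lamSubst, map_smul, map_mul, lamSubst_lamSubst, hf, ha, lamSubst_perm hc, lamSubst_self,
    hsign, lamSubst_C]
  rw [mul_smul_comm, smul_smul]
  have hpow : (-1 : ℂ) ^ (((0 : Fin (n + 2)) : ℕ) + ((k.succ : Fin (n + 2)) : ℕ)) *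
      (-1) ^ (k : ℕ) = -1 := by
    rw [← pow_add]
    exact Odd.neg_one_pow ⟨k, by simp; ring⟩
  have hlin : MvPolynomial.aeval (Fin.cons 0 MvPolynomial.X :
      Fin (n + 2) → MvPolynomial (Fin (n + 1)) ℂ)
      (MvPolynomial.C (SVbrk L (a k)).2.2 * MvPolynomial.X 0 -
        MvPolynomial.C 1 * (MvPolynomial.X 0 + MvPolynomial.X k.succ)) =
        (-1 : ℂ) • MvPolynomial.X k := by
    simp
  rw [hpow, hlin, ← Polynomial.smul_C, smul_mul_assoc, smul_smul]
  simp

lemma contractL_MdTerm_succ {n : ℕ} {c : MRaw (n + 2)} (hc : c ∈ MCochain (n + 2))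
    (a : Fin (n + 2) → SVGen) (i j : Fin (n + 2)) :
    lamSubst (Fin.cons 0 MvPolynomial.X) (MdTerm c (Fin.cons L a) i.succ j.succ) =
      (-1 : ℂ) • MdTerm (contractL (n + 1) c) a i j := by
  have hmin : (⟨min (i.succ : ℕ) (n + 1), Nat.lt_succ_of_le (Nat.min_le_right _ _)⟩ :
      Fin (n + 2)) =
        (⟨min (i : ℕ) n, Nat.lt_succ_of_le (Nat.min_le_right _ _)⟩ : Fin (n + 1)).succ := by
    ext; simp
  have hskip0 : SVskip i.succ j.succ (0 : Fin (n + 1)) = 0 := by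
    rw [SVskip, hmin]; simp
  have hskip : ∀ m : Fin n, SVskip i.succ j.succ m.succ = (SVskip i j m).succ := by
    intro m
    rw [SVskip, hmin, Fin.succ_succAbove_succ, Fin.succ_succAbove_succ, SVskip]
  set b := SVbrk (a i) (a j) with hb
  set τ : Equiv.Perm (Fin (n + 2)) := Equiv.swap 0 1 with hτ
  have hτs : ∀ m : Fin n, τ m.succ.succ = m.succ.succ := fun m =>
    Equiv.swap_apply_of_ne_of_ne (Fin.succ_ne_zero _)
      (by rw [← Fin.succ_zero_eq_one]; exact fun h => Fin.succ_ne_zero m (Fin.succ_injective _ h))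
  have hτ1 : τ (Fin.succ 0) = 0 := by simp [hτ]
  have hτ0 : τ 0 = Fin.succ 0 := by simp [hτ]
  have ha : (Fin.cons b.1 fun m => (Fin.cons L a : Fin (n + 3) → SVGen)
        (SVskip i.succ j.succ m) : Fin (n + 2) → SVGen) =
      (Fin.cons L (Fin.cons b.1 fun m => a (SVskip i j m) : Fin (n + 1) → SVGen) :
        Fin (n + 2) → SVGen) ∘ τ := by
    funext m
    refine Fin.cases ?_ (fun m => Fin.cases ?_ (fun m => ?_) m) m
    · rw [Function.comp_apply, hτ0]; simp
    · rw [Function.comp_apply, hτ1, Fin.cons_succ, hskip0]; simp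
    · rw [Function.comp_apply, hτs, Fin.cons_succ, hskip]; simp
  have hf : (fun m => MvPolynomial.aeval (Fin.cons 0 MvPolynomial.X :
        Fin (n + 3) → MvPolynomial (Fin (n + 2)) ℂ)
        ((Fin.cons (MvPolynomial.X i.succ + MvPolynomial.X j.succ)
          fun m => MvPolynomial.X (SVskip i.succ j.succ m) :
            Fin (n + 2) → MvPolynomial (Fin (n + 3)) ℂ) m)) =
      (fun m => MvPolynomial.aeval (Fin.cons (MvPolynomial.X i + MvPolynomial.X j)
          fun k => MvPolynomial.X (SVskip i j k) : Fin (n + 1) → MvPolynomial (Fin (n + 2)) ℂ)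
        ((Fin.cons 0 MvPolynomial.X : Fin (n + 2) → MvPolynomial (Fin (n + 1)) ℂ) m)) ∘ τ := by
    funext m
    refine Fin.cases ?_ (fun m => Fin.cases ?_ (fun m => ?_) m) m
    · rw [Function.comp_apply, hτ0]; simp
    · rw [Function.comp_apply, hτ1, Fin.cons_succ, hskip0]; simp
    · rw [Function.comp_apply, hτs, Fin.cons_succ, hskip]; simp
  have hsign : (((Equiv.Perm.sign τ : ℤˣ) : ℤ) : ℂ) = -1 := by
    rw [hτ, Equiv.Perm.sign_swap (by simp)]; simp
  rw [MdTerm, MdTerm, contractL]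
  simp only [Fin.cons_succ]
  rw [← hb, ← lamSubst, ← lamSubst, map_smul, map_mul, lamSubst_lamSubst, lamSubst_lamSubst, hf,
    ha, lamSubst_perm hc, hsign, lamSubst_C]
  have hpow : (-1 : ℂ) ^ ((i.succ : ℕ) + (j.succ : ℕ)) = (-1) ^ ((i : ℕ) + (j : ℕ)) := by
    rw [Fin.val_succ, Fin.val_succ, show (i : ℕ) + 1 + (j + 1) = i + j + 2 by ring, pow_add]
    simp
  have hlin : MvPolynomial.aeval (Fin.cons 0 MvPolynomial.X :
      Fin (n + 3) → MvPolynomial (Fin (n + 2)) ℂ)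
      (MvPolynomial.C b.2.2 * MvPolynomial.X i.succ -
        MvPolynomial.C b.2.1 * (MvPolynomial.X i.succ + MvPolynomial.X j.succ)) =
        MvPolynomial.C b.2.2 * MvPolynomial.X i -
          MvPolynomial.C b.2.1 * (MvPolynomial.X i + MvPolynomial.X j) := by
    simp [MvPolynomial.algebraMap_eq]
  rw [hpow, hlin, mul_smul_comm, smul_comm]

/-- In degree zero, contracting the differential gives the action of `L` at `λ = 0`. -/
lemma contractL_Md_zero (α β : ℂ) (c : MRaw 0) :
    contractL 0 (Md α β c) = Mpartial 0 c + β • c := by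
  funext a
  simp only [contractL, Md, Finset.univ_unique, Finset.sum_singleton, Fin.default_eq_zero]
  rw [contractL_MActTerm_zero]
  simp [Mpartial, add_mul, Algebra.smul_def, Polynomial.algebraMap_apply,
    MvPolynomial.algebraMap_eq]

/-- Cartan's formula: the anticommutator of `d` and the contraction with `L` at `λ = 0` is
`∂ + β`. -/
lemma contractL_Md_succ (α β : ℂ) {n : ℕ} {c : MRaw (n + 1)} (hc : c ∈ MCochain (n + 1)) :
    contractL (n + 1) (Md α β c) + Md α β (contractL n c) = Mpartial (n + 1) c + β • c := by
  funext a
  have hact : lamSubst (Fin.cons 0 MvPolynomial.X)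
        (∑ i, MActTerm α β c (Fin.cons L a) i) =
      (Polynomial.X + Polynomial.C (MvPolynomial.C β)) * c a +
        (-1 : ℂ) • ∑ i, MActTerm α β (contractL n c) a i := by
    rw [Fin.sum_univ_succ, map_add, contractL_MActTerm_zero, map_sum]
    simp only [contractL_MActTerm_succ, Finset.smul_sum]
  have hbr : lamSubst (Fin.cons 0 MvPolynomial.X)
        (∑ i : Fin (n + 2), ∑ j : Fin (n + 2),
          if (i : ℕ) < (j : ℕ) then MdTerm c (Fin.cons L a) i j else 0) =
      Polynomial.C (∑ i, MvPolynomial.X i) * c a +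
        ∑ i : Fin (n + 1), ∑ j : Fin (n + 1), if (i : ℕ) < (j : ℕ) then
          lamSubst (Fin.cons 0 MvPolynomial.X) (MdTerm c (Fin.cons L a) i.succ j.succ)
          else 0 := by
    simp [Fin.sum_univ_succ (n := n + 1), apply_ite, contractL_MdTerm_zero hc, Finset.sum_mul]
  have hrhs : (Mpartial (n + 1) c + β • c) a =
      (Polynomial.X + Polynomial.C (MvPolynomial.C β)) * c a +
        Polynomial.C (∑ i, MvPolynomial.X i) * c a := by
    have hsmul : β • c a = Polynomial.C (MvPolynomial.C β) * c a := by
      rw [Algebra.smul_def, Polynomial.algebraMap_apply, MvPolynomial.algebraMap_eq]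
    rw [Pi.add_apply, Pi.smul_apply, hsmul]
    simp only [Mpartial, LinearMap.coe_mk, AddHom.coe_mk, add_mul]
    abel
  rw [hrhs, Pi.add_apply, contractL, Md, map_add, hact, hbr]
  cases n with
  | zero =>
    simp [Md]
    module
  | succ n =>
    have hneg : (∑ i : Fin (n + 2), ∑ j : Fin (n + 2), if (i : ℕ) < (j : ℕ) then
          (-1 : ℂ) • MdTerm (contractL (n + 1) c) a i j else 0) =
        (-1 : ℂ) • ∑ i : Fin (n + 2), ∑ j : Fin (n + 2), if (i : ℕ) < (j : ℕ) then
          MdTerm (contractL (n + 1) c) a i j else 0 := by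
      simp only [Finset.smul_sum, smul_ite, smul_zero]
    simp only [contractL_MdTerm_succ hc, Md, hneg]
    module

/-- For `β ≠ 0` every reduced cocycle is a reduced coboundary. -/
lemma MredCocycles_le_MredCoboundaries (α β : ℂ) (hβ : β ≠ 0) (q : ℕ) :
    MredCocycles α β q ≤ MredCoboundaries α β q := by
  rintro c ⟨hc, φ, hφ, hd⟩
  replace hd : Md α β c = Mpartial (q + 1) φ := hd.symm
  have hmem : Mpartial q (contractL q φ - c) ∈ MpartialSub q :=
    ⟨_, sub_mem (contractL_mem hφ) hc, rfl⟩
  rw [← Submodule.smul_mem_iff _ hβ]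
  cases q with
  | zero =>
    have h := contractL_Md_zero α β c
    rw [hd, contractL_partial] at h
    have hx : β • c = Mpartial 0 (contractL 0 φ - c) := by
      rw [map_sub, h]; abel
    rw [hx]
    exact hmem
  | succ n =>
    have h := contractL_Md_succ α β hc
    rw [hd, contractL_partial] at h
    have hx : β • c = Mpartial (n + 1) (contractL (n + 1) φ - c) +
        MdLin α β n (contractL n c) := by
      rw [map_sub, sub_add_eq_add_sub]
      exact eq_sub_of_add_eq' h.symm
    rw [hx]
    exact Submodule.add_mem_sup hmem ⟨_, contractL_mem hc, rfl⟩

/-- For `β ≠ 0`, the reduced cohomology of `SV` with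
coefficients in `M_{α,β}` vanishes in every degree: every reduced cocycle is a
reduced coboundary. -/
theorem statement18 (α β : ℂ) (hβ : β ≠ 0) (q : ℕ) :
    MredCocycles α β q ≤ MredCoboundaries α β q ∧ Subsingleton (MredH α β q) := by
  have h := MredCocycles_le_MredCoboundaries α β hβ q
  refine ⟨h, ?_⟩
  unfold MredH
  rw [Submodule.Quotient.subsingleton_iff, Submodule.comap_subtype_eq_top]
  exact h

end SVCA
end
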